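/- arXiv:1506.01604 — 7 statements merged into one kernel-verified Lean document; each statement's English description precedes it below -/
import Mathlib

section
/- In ℤ[SL₂(F)], the element A satisfies A·X = X·A = (q−1)·X for every X ∈ {A, B, C, D₊, D₋, E₊, E₋}. -/
open MonoidAlgebra

/-- Sum of all elements of `SL₂(F)` whose support pattern is given by the four
Booleans (`true` = the entry is nonzero, `false` = the entry is zero). -/
noncomputable def suppClass (R : Type*) [CommRing R] (F : Type*) [Field F] [Fintype F]
    [DecidableEq F] (b₁₁ b₁₂ b₂₁ b₂₂ : Bool) :
    MonoidAlgebra R (Matrix.SpecialLinearGroup (Fin 2) F) :=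
  ∑ g ∈ Finset.univ.filter
      (fun g : Matrix.SpecialLinearGroup (Fin 2) F =>
        (b₁₁ = true ↔ (g : Matrix (Fin 2) (Fin 2) F) 0 0 ≠ 0) ∧
        (b₁₂ = true ↔ (g : Matrix (Fin 2) (Fin 2) F) 0 1 ≠ 0) ∧
        (b₂₁ = true ↔ (g : Matrix (Fin 2) (Fin 2) F) 1 0 ≠ 0) ∧
        (b₂₂ = true ↔ (g : Matrix (Fin 2) (Fin 2) F) 1 1 ≠ 0)),
    MonoidAlgebra.of R (Matrix.SpecialLinearGroup (Fin 2) F) g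

/-- The support class `A` (diagonal matrices). -/
noncomputable def elA (R : Type*) [CommRing R] (F : Type*) [Field F] [Fintype F] [DecidableEq F] :=
  suppClass R F true false false true
/-- The support class `B` (antidiagonal matrices). -/
noncomputable def elB (R : Type*) [CommRing R] (F : Type*) [Field F] [Fintype F] [DecidableEq F] :=
  suppClass R F false true true false
/-- The support class `C` (matrices with all entries nonzero). -/
noncomputable def elC (R : Type*) [CommRing R] (F : Type*) [Field F] [Fintype F] [DecidableEq F] :=
  suppClass R F true true true true
/-- The support class `D₊` (upper triangular with nonzero entries). -/
noncomputable def elDp (R : Type*) [CommRing R] (F : Type*) [Field F] [Fintype F] [DecidableEq F] :=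
  suppClass R F true true false true
/-- The support class `D₋` (lower triangular with nonzero entries). -/
noncomputable def elDm (R : Type*) [CommRing R] (F : Type*) [Field F] [Fintype F] [DecidableEq F] :=
  suppClass R F true false true true
/-- The support class `E₊`. -/
noncomputable def elEp (R : Type*) [CommRing R] (F : Type*) [Field F] [Fintype F] [DecidableEq F] :=
  suppClass R F true true true false
/-- The support class `E₋`. -/
noncomputable def elEm (R : Type*) [CommRing R] (F : Type*) [Field F] [Fintype F] [DecidableEq F] :=
  suppClass R F false true true true

theorem card_diag_aux (F : Type*) [Field F] [Fintype F] [DecidableEq F] :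
    (Finset.univ.filter (fun g : Matrix.SpecialLinearGroup (Fin 2) F =>
        (true = true ↔ (g : Matrix (Fin 2) (Fin 2) F) 0 0 ≠ 0) ∧
        (false = true ↔ (g : Matrix (Fin 2) (Fin 2) F) 0 1 ≠ 0) ∧
        (false = true ↔ (g : Matrix (Fin 2) (Fin 2) F) 1 0 ≠ 0) ∧
        (true = true ↔ (g : Matrix (Fin 2) (Fin 2) F) 1 1 ≠ 0))).card
      = Fintype.card Fˣ := by
  symm
  rw [← Finset.card_univ]
  refine Finset.card_bij
    (fun (u : Fˣ) _ => (⟨!![(u : F), 0; 0, ((u⁻¹ : Fˣ) : F)], by simp [Matrix.det_fin_two]⟩ :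
      Matrix.SpecialLinearGroup (Fin 2) F)) ?_ ?_ ?_
  · intro u _
    refine Finset.mem_filter.mpr ⟨Finset.mem_univ _, ?_, ?_, ?_, ?_⟩ <;> simp
  · intro u _ v _ h
    have h1 := congrArg (fun g : Matrix.SpecialLinearGroup (Fin 2) F =>
      (g : Matrix (Fin 2) (Fin 2) F) 0 0) h
    exact Units.ext (by simpa using h1)
  · intro g hg
    simp only [Finset.mem_filter, Finset.mem_univ, true_and, true_iff, Bool.false_eq_true,
      false_iff, not_not] at hg
    obtain ⟨h0, h1, h2, h3⟩ := hg
    have hd := g.det_coe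
    rw [Matrix.det_fin_two, h1, h2] at hd
    refine ⟨Units.mk0 _ h0, Finset.mem_univ _, ?_⟩
    ext i j
    fin_cases i <;> fin_cases j
    · simp
    · simp [h1]
    · simp [h2]
    · simp
      exact inv_eq_of_mul_eq_one_right (by simpa using hd)

theorem mul_suppClass_aux (F : Type*) [Field F] [Fintype F] [DecidableEq F]
    (g : Matrix.SpecialLinearGroup (Fin 2) F)
    (h0 : (g : Matrix (Fin 2) (Fin 2) F) 0 0 ≠ 0) (h1 : (g : Matrix (Fin 2) (Fin 2) F) 0 1 = 0)
    (h2 : (g : Matrix (Fin 2) (Fin 2) F) 1 0 = 0) (h3 : (g : Matrix (Fin 2) (Fin 2) F) 1 1 ≠ 0)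
    (a b c d : Bool) :
    MonoidAlgebra.of ℤ _ g * suppClass ℤ F a b c d = suppClass ℤ F a b c d ∧
    suppClass ℤ F a b c d * MonoidAlgebra.of ℤ _ g = suppClass ℤ F a b c d := by
  unfold suppClass
  rw [Finset.mul_sum, Finset.sum_mul]
  constructor
  · refine Finset.sum_equiv (Equiv.mulLeft g) ?_ ?_
    · intro x
      simp [Matrix.mul_apply, Fin.sum_univ_two, h0, h1, h2, h3]
    · intro x _
      rw [← map_mul]; rfl
  · refine Finset.sum_equiv (Equiv.mulRight g) ?_ ?_
    · intro x
      simp [Matrix.mul_apply, Fin.sum_univ_two, h0, h1, h2, h3]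
    · intro x _
      rw [← map_mul]; rfl

theorem elA_mul_suppClass (F : Type*) [Field F] [Fintype F] [DecidableEq F]
    (q : ℤ) (hqc : q = Fintype.card F) (a b c d : Bool) :
    elA ℤ F * suppClass ℤ F a b c d = (q - 1) • suppClass ℤ F a b c d ∧
    suppClass ℤ F a b c d * elA ℤ F = (q - 1) • suppClass ℤ F a b c d := by
  have hc : q - 1 = ((Fintype.card Fˣ : ℕ) : ℤ) := by
    rw [hqc, Fintype.card_units, Nat.cast_sub Fintype.card_pos]; simp
  rw [hc, natCast_zsmul, ← card_diag_aux F]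
  generalize hX : suppClass ℤ F a b c d = X
  unfold elA suppClass
  rw [Finset.mul_sum, Finset.sum_mul]
  constructor <;>
  · rw [← Finset.sum_const]
    refine Finset.sum_congr rfl fun g hg => ?_
    simp only [Finset.mem_filter, Finset.mem_univ, true_and, true_iff, Bool.false_eq_true,
      false_iff, not_not] at hg
    obtain ⟨h0, h1, h2, h3⟩ := hg
    have := mul_suppClass_aux F g h0 h1 h2 h3 a b c d
    rw [hX] at this
    first | exact this.1 | exact this.2

theorem mul_elA (F : Type*) [Field F] [Fintype F] [DecidableEq F]
    (hq : 2 < Fintype.card F) (q : ℤ) (hqc : q = Fintype.card F) :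
    ∀ X ∈ ({elA ℤ F, elB ℤ F, elC ℤ F, elDp ℤ F, elDm ℤ F, elEp ℤ F, elEm ℤ F} : Set (MonoidAlgebra ℤ (Matrix.SpecialLinearGroup (Fin 2) F))),
      elA ℤ F * X = (q - 1) • X ∧ X * elA ℤ F = (q - 1) • X := by
  intro X hX
  simp only [Set.mem_insert_iff, Set.mem_singleton_iff] at hX
  rcases hX with rfl | rfl | rfl | rfl | rfl | rfl | rfl <;>
    exact elA_mul_suppClass F q hqc _ _ _ _
end

section
/- In ℤ[SL₂(F)] the following products with B hold: B² = (q−1)·A; B·C = C·B = (q−1)·C; B·D₊ = D₋·B = (q−1)·E₋; B·D₋ = D₊·B = (q−1)·E₊; B·E₊ = E₋·B = (q−1)·D₋; B·E₋ = E₊·B = (q−1)·D₊. -/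
open MonoidAlgebra

theorem left_aux (F : Type*) [Field F] [Fintype F] [DecidableEq F] (p q r s : Bool)
    (b : Matrix.SpecialLinearGroup (Fin 2) F) (h0 : b.1 0 0 = 0) (h1 : b.1 0 1 ≠ 0)
    (h2 : b.1 1 0 ≠ 0) (h3 : b.1 1 1 = 0) :
    MonoidAlgebra.of ℤ (Matrix.SpecialLinearGroup (Fin 2) F) b * suppClass ℤ F p q r s
      = suppClass ℤ F r s p q := by
  unfold suppClass
  rw [Finset.mul_sum]
  refine Finset.sum_equiv (Equiv.mulLeft b) ?_ ?_
  · intro g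
    simp [Matrix.mul_apply, Fin.sum_univ_two, h0, h1, h2, h3]
    tauto
  · intro g _
    rw [← map_mul]; rfl

theorem right_aux (F : Type*) [Field F] [Fintype F] [DecidableEq F] (p q r s : Bool)
    (b : Matrix.SpecialLinearGroup (Fin 2) F) (h0 : b.1 0 0 = 0) (h1 : b.1 0 1 ≠ 0)
    (h2 : b.1 1 0 ≠ 0) (h3 : b.1 1 1 = 0) :
    suppClass ℤ F p q r s * MonoidAlgebra.of ℤ (Matrix.SpecialLinearGroup (Fin 2) F) b
      = suppClass ℤ F q p s r := by
  unfold suppClass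
  rw [Finset.sum_mul]
  refine Finset.sum_equiv (Equiv.mulRight b) ?_ ?_
  · intro g
    simp [Matrix.mul_apply, Fin.sum_univ_two, h0, h1, h2, h3]
    tauto
  · intro g _
    rw [← map_mul]; rfl

theorem card_aux (F : Type*) [Field F] [Fintype F] [DecidableEq F] :
    (((Finset.univ.filter
      (fun g : Matrix.SpecialLinearGroup (Fin 2) F =>
        (false = true ↔ (g : Matrix (Fin 2) (Fin 2) F) 0 0 ≠ 0) ∧
        (true = true ↔ (g : Matrix (Fin 2) (Fin 2) F) 0 1 ≠ 0) ∧
        (true = true ↔ (g : Matrix (Fin 2) (Fin 2) F) 1 0 ≠ 0) ∧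
        (false = true ↔ (g : Matrix (Fin 2) (Fin 2) F) 1 1 ≠ 0))).card : ℕ) : ℤ)
      = (Fintype.card F : ℤ) - 1 := by
  have h : (Finset.univ.filter
      (fun g : Matrix.SpecialLinearGroup (Fin 2) F =>
        (false = true ↔ (g : Matrix (Fin 2) (Fin 2) F) 0 0 ≠ 0) ∧
        (true = true ↔ (g : Matrix (Fin 2) (Fin 2) F) 0 1 ≠ 0) ∧
        (true = true ↔ (g : Matrix (Fin 2) (Fin 2) F) 1 0 ≠ 0) ∧
        (false = true ↔ (g : Matrix (Fin 2) (Fin 2) F) 1 1 ≠ 0))).card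
      = (Finset.univ : Finset Fˣ).card := by
    symm
    refine Finset.card_bij (fun u _ => ⟨!![0, (u : F); -(u : F)⁻¹, 0], by
      simp [Matrix.det_fin_two]⟩) ?_ ?_ ?_
    · intro u _
      refine Finset.mem_filter.mpr ⟨Finset.mem_univ _, ?_⟩
      simp
    · intro u _ v _ huv
      have := congrArg (fun g : Matrix.SpecialLinearGroup (Fin 2) F => g.1 0 1) huv
      simpa [Units.ext_iff] using this
    · intro g hg
      simp at hg
      obtain ⟨h0, h1, h2, h3⟩ := hg
      refine ⟨Units.mk0 _ h1, Finset.mem_univ _, ?_⟩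
      have hd := g.2
      rw [Matrix.det_fin_two, h0] at hd
      ext i j
      fin_cases i <;> fin_cases j <;> simp [h0, h3]
      rw [neg_eq_iff_eq_neg]
      apply inv_eq_of_mul_eq_one_right
      linear_combination hd
  rw [h, Finset.card_univ, Fintype.card_units,
    Nat.cast_sub (Nat.one_le_iff_ne_zero.mpr Fintype.card_ne_zero)]
  simp

theorem left_main (F : Type*) [Field F] [Fintype F] [DecidableEq F] (p q r s : Bool) :
    elB ℤ F * suppClass ℤ F p q r s = ((Fintype.card F : ℤ) - 1) • suppClass ℤ F r s p q := by
  rw [← card_aux F, natCast_zsmul, ← Finset.sum_const]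
  rw [elB]
  conv_lhs => rw [suppClass.eq_1 ℤ F false true true false, Finset.sum_mul]
  refine Finset.sum_congr rfl fun b hb => ?_
  simp at hb
  exact left_aux F p q r s b hb.1 hb.2.1 hb.2.2.1 hb.2.2.2

theorem right_main (F : Type*) [Field F] [Fintype F] [DecidableEq F] (p q r s : Bool) :
    suppClass ℤ F p q r s * elB ℤ F = ((Fintype.card F : ℤ) - 1) • suppClass ℤ F q p s r := by
  rw [← card_aux F, natCast_zsmul, ← Finset.sum_const]
  rw [elB]
  conv_lhs => rw [suppClass.eq_1 ℤ F false true true false, Finset.mul_sum]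
  refine Finset.sum_congr rfl fun b hb => ?_
  simp at hb
  exact right_aux F p q r s b hb.1 hb.2.1 hb.2.2.1 hb.2.2.2

theorem mul_elB (F : Type*) [Field F] [Fintype F] [DecidableEq F]
    (hq : 2 < Fintype.card F) (q : ℤ) (hqc : q = Fintype.card F) :
    elB ℤ F * elB ℤ F = (q - 1) • elA ℤ F ∧
    elB ℤ F * elC ℤ F = (q - 1) • elC ℤ F ∧
    elC ℤ F * elB ℤ F = (q - 1) • elC ℤ F ∧
    elB ℤ F * elDp ℤ F = (q - 1) • elEm ℤ F ∧
    elDm ℤ F * elB ℤ F = (q - 1) • elEm ℤ F ∧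
    elB ℤ F * elDm ℤ F = (q - 1) • elEp ℤ F ∧
    elDp ℤ F * elB ℤ F = (q - 1) • elEp ℤ F ∧
    elB ℤ F * elEp ℤ F = (q - 1) • elDm ℤ F ∧
    elEm ℤ F * elB ℤ F = (q - 1) • elDm ℤ F ∧
    elB ℤ F * elEm ℤ F = (q - 1) • elDp ℤ F ∧
    elEp ℤ F * elB ℤ F = (q - 1) • elDp ℤ F := by
  subst hqc
  exact ⟨left_main F _ _ _ _, left_main F _ _ _ _, right_main F _ _ _ _, left_main F _ _ _ _,
    right_main F _ _ _ _, left_main F _ _ _ _, right_main F _ _ _ _, left_main F _ _ _ _,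
    right_main F _ _ _ _, left_main F _ _ _ _, right_main F _ _ _ _⟩
end

section
/- In ℤ[SL₂(F)] one has C² = (q−1)²(q−2)·(A+B) + (q−1)(q−3)(q−4)·C + (q−1)(q−2)(q−3)·(D₊+D₋+E₊+E₋). -/
open MonoidAlgebra

/-- The support-pattern predicate. -/
def suppPat (F : Type*) [Field F] (b₁₁ b₁₂ b₂₁ b₂₂ : Bool)
    (g : Matrix.SpecialLinearGroup (Fin 2) F) : Prop :=
  (b₁₁ = true ↔ (g : Matrix (Fin 2) (Fin 2) F) 0 0 ≠ 0) ∧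
  (b₁₂ = true ↔ (g : Matrix (Fin 2) (Fin 2) F) 0 1 ≠ 0) ∧
  (b₂₁ = true ↔ (g : Matrix (Fin 2) (Fin 2) F) 1 0 ≠ 0) ∧
  (b₂₂ = true ↔ (g : Matrix (Fin 2) (Fin 2) F) 1 1 ≠ 0)

instance (F : Type*) [Field F] [DecidableEq F] (b₁₁ b₁₂ b₂₁ b₂₂ : Bool)
    (g : Matrix.SpecialLinearGroup (Fin 2) F) : Decidable (suppPat F b₁₁ b₁₂ b₂₁ b₂₂ g) := by
  unfold suppPat; infer_instance

theorem suppClass_eq (F : Type*) [Field F] [Fintype F] [DecidableEq F]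
    (b₁₁ b₁₂ b₂₁ b₂₂ : Bool) :
    suppClass ℤ F b₁₁ b₁₂ b₂₁ b₂₂ = ∑ g ∈ Finset.univ.filter (suppPat F b₁₁ b₁₂ b₂₁ b₂₂),
      MonoidAlgebra.single g (1 : ℤ) := by
  unfold suppClass
  apply Finset.sum_congr
  · ext g; simp [suppPat]
  · intros; rfl

theorem suppClass_coeff (F : Type*) [Field F] [Fintype F] [DecidableEq F]
    (b₁₁ b₁₂ b₂₁ b₂₂ : Bool) (g : Matrix.SpecialLinearGroup (Fin 2) F) :
    (suppClass ℤ F b₁₁ b₁₂ b₂₁ b₂₂).coeff g = if suppPat F b₁₁ b₁₂ b₂₁ b₂₂ g then 1 else 0 := by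
  rw [suppClass_eq]
  simp [MonoidAlgebra.coeff_sum, Finsupp.single_apply, Finset.sum_ite_eq]

/-- The admissible ratios. -/
def ratios (F : Type*) [Field F] [Fintype F] [DecidableEq F] (x y z w : F) : Finset F :=
  Finset.univ \ {0, x / z, y / w}

theorem mem_ratios {F : Type*} [Field F] [Fintype F] [DecidableEq F] {x y z w : F}
    (h : x * w - y * z = 1) (t : F) :
    t ∈ ratios F x y z w ↔ t ≠ 0 ∧ x ≠ t * z ∧ y ≠ t * w := by
  have key : ∀ p r : F, (r = 0 → p ≠ 0) → t ≠ 0 → (t = p / r ↔ p = t * r) := by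
    intro p r hr ht
    by_cases h0 : r = 0
    · simp [h0, hr h0, ht]
    · rw [eq_div_iff h0]; exact eq_comm
  have h1 : z = 0 → x ≠ 0 := by rintro rfl rfl; simp at h
  have h2 : w = 0 → y ≠ 0 := by rintro rfl rfl; simp at h
  simp only [ratios, Finset.mem_sdiff, Finset.mem_univ, true_and, Finset.mem_insert,
    Finset.mem_singleton, not_or]
  constructor
  · rintro ⟨a, b, c⟩
    exact ⟨a, mt (key x z h1 a).2 b, mt (key y w h2 a).2 c⟩
  · rintro ⟨a, b, c⟩
    exact ⟨a, mt (key x z h1 a).1 b, mt (key y w h2 a).1 c⟩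

theorem suppPat_inv_mul (F : Type*) [Field F] (h g : Matrix.SpecialLinearGroup (Fin 2) F) :
    suppPat F true true true true (h⁻¹ * g) ↔
      (h.1 1 1 * g.1 0 0 + -h.1 0 1 * g.1 1 0 ≠ 0 ∧
        h.1 1 1 * g.1 0 1 + -h.1 0 1 * g.1 1 1 ≠ 0 ∧
        -h.1 1 0 * g.1 0 0 + h.1 0 0 * g.1 1 0 ≠ 0 ∧
        -h.1 1 0 * g.1 0 1 + h.1 0 0 * g.1 1 1 ≠ 0) := by
  simp only [suppPat, true_iff,
    Matrix.SpecialLinearGroup.coe_mul, Matrix.SpecialLinearGroup.coe_inv,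
    Matrix.adjugate_fin_two, Matrix.mul_apply, Fin.sum_univ_two, Matrix.of_apply,
    Matrix.cons_val_zero, Matrix.cons_val_one, Matrix.cons_val', Matrix.cons_val_fin_one]

theorem pair_card (F : Type*) [Field F] [Fintype F] [DecidableEq F]
    (g : Matrix.SpecialLinearGroup (Fin 2) F) :
    (Finset.univ.filter (fun h : Matrix.SpecialLinearGroup (Fin 2) F =>
      suppPat F true true true true h ∧ suppPat F true true true true (h⁻¹ * g))).card =
    ((Finset.univ.filter (fun c : F => c ≠ 0)) ×ˢ
      (ratios F (g.1 0 0) (g.1 0 1) (g.1 1 0) (g.1 1 1)).offDiag).card := by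
  have hg := g.2
  rw [Matrix.det_fin_two] at hg
  refine Finset.card_bij' (fun h _ => (h.1 1 0, (h.1 0 1 / h.1 1 1, h.1 0 0 / h.1 1 0)))
    (fun p hp => ⟨!![p.2.2 * p.1, p.2.1 / (p.1 * (p.2.2 - p.2.1));
        p.1, 1 / (p.1 * (p.2.2 - p.2.1))], ?_⟩) ?_ ?_ ?_ ?_
  · simp only [Finset.mem_product, Finset.mem_filter, Finset.mem_offDiag] at hp
    have h1 : p.1 ≠ 0 := hp.1.2
    have h2 : p.2.2 - p.2.1 ≠ 0 := sub_ne_zero.2 (Ne.symm hp.2.2.2)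
    rw [Matrix.det_fin_two_of]
    field_simp
  · intro h hh
    have hd := h.2
    rw [Matrix.det_fin_two] at hd
    simp only [Finset.mem_product, Finset.mem_filter, Finset.mem_offDiag, Finset.mem_univ,
      true_and, mem_ratios hg]
    simp only [Finset.mem_filter, suppPat, Finset.mem_univ, true_and, true_iff,
      Matrix.SpecialLinearGroup.coe_mul, Matrix.SpecialLinearGroup.coe_inv,
      Matrix.adjugate_fin_two, Matrix.mul_apply, Fin.sum_univ_two, Matrix.of_apply,
      Matrix.cons_val_zero, Matrix.cons_val_one, Matrix.cons_val', Matrix.cons_val_fin_one] at hh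
    obtain ⟨⟨a0, b0, c0, d0⟩, e1, e2, e3, e4⟩ := hh
    refine ⟨c0, ⟨div_ne_zero b0 d0, ?_, ?_⟩, ⟨div_ne_zero a0 c0, ?_, ?_⟩, ?_⟩
    · intro e; apply e1; rw [e]; field_simp; ring
    · intro e; apply e2; rw [e]; field_simp; ring
    · intro e; apply e3; rw [e]; field_simp; ring
    · intro e; apply e4; rw [e]; field_simp; ring
    · intro e; rw [div_eq_div_iff d0 c0] at e
      have : (0 : F) = 1 := by rw [← hd]; linear_combination e
      exact zero_ne_one this
  · rintro ⟨c, u, v⟩ hp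
    simp only [Finset.mem_product, Finset.mem_filter, Finset.mem_offDiag, Finset.mem_univ,
      true_and, mem_ratios hg] at hp
    obtain ⟨c0, ⟨u0, u1, u2⟩, ⟨v0, v1, v2⟩, huv⟩ := hp
    have h2 : v - u ≠ 0 := sub_ne_zero.2 (Ne.symm huv)
    have h3 : c * (v - u) ≠ 0 := mul_ne_zero c0 h2
    refine Finset.mem_filter.2 ⟨Finset.mem_univ _, ?_⟩
    refine (and_congr_right fun _ => suppPat_inv_mul F _ g).2 ?_
    simp only [suppPat, true_iff, Matrix.of_apply,
      Matrix.cons_val_zero, Matrix.cons_val_one, Matrix.cons_val', Matrix.cons_val_fin_one]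
    refine ⟨⟨mul_ne_zero v0 c0, div_ne_zero u0 h3, c0, one_div_ne_zero h3⟩, ?_, ?_, ?_, ?_⟩
    · intro e; field_simp at e; apply u1; linear_combination e
    · intro e; field_simp at e; apply u2; linear_combination e
    · intro e; apply v1; apply mul_left_cancel₀ c0; linear_combination -e
    · intro e; apply v2; apply mul_left_cancel₀ c0; linear_combination -e
  · intro h hh
    have hd := h.2
    rw [Matrix.det_fin_two] at hd
    simp only [Finset.mem_filter, suppPat, Finset.mem_univ, true_and, true_iff] at hh
    obtain ⟨⟨a0, b0, c0, d0⟩, -⟩ := hh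
    have hk : h.1 1 0 * (h.1 0 0 / h.1 1 0 - h.1 0 1 / h.1 1 1) = 1 / h.1 1 1 := by
      field_simp; linear_combination hd
    apply Subtype.ext
    ext i j
    fin_cases i <;> fin_cases j <;> simp [hk, a0, b0, c0, d0] <;> field_simp
  · rintro ⟨c, u, v⟩ hp
    simp only [Finset.mem_product, Finset.mem_filter, Finset.mem_offDiag, Finset.mem_univ,
      true_and] at hp
    obtain ⟨c0, -, -, huv⟩ := hp
    have h2 : v - u ≠ 0 := sub_ne_zero.2 (Ne.symm huv)
    simp [c0]
    field_simp

theorem sq_coeff (F : Type*) [Field F] [Fintype F] [DecidableEq F]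
    (g : Matrix.SpecialLinearGroup (Fin 2) F) :
    (elC ℤ F * elC ℤ F).coeff g =
    ((Finset.univ.filter (fun h : Matrix.SpecialLinearGroup (Fin 2) F =>
      suppPat F true true true true h ∧ suppPat F true true true true (h⁻¹ * g))).card : ℤ) := by
  have h1 : elC ℤ F * elC ℤ F = ∑ h ∈ Finset.univ.filter (suppPat F true true true true),
      MonoidAlgebra.single h (1 : ℤ) * elC ℤ F := by
    rw [← Finset.sum_mul, ← suppClass_eq]; rfl
  rw [h1, MonoidAlgebra.coeff_sum, Finsupp.finsetSum_apply, ← Finset.filter_filter,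
    Finset.card_filter]
  push_cast
  apply Finset.sum_congr rfl
  intro h _
  rw [MonoidAlgebra.coeff_single_mul_apply, one_mul, elC, suppClass_coeff]

theorem ratios_card {F : Type*} [Field F] [Fintype F] [DecidableEq F] (x y z w : F) :
    ((ratios F x y z w).card : ℤ) =
      Fintype.card F - (({0, x / z, y / w} : Finset F).card : ℤ) := by
  have := Finset.card_sdiff_add_card_eq_card (Finset.subset_univ ({0, x / z, y / w} : Finset F))
  rw [Finset.card_univ] at this
  rw [ratios]; omega

theorem elC_sq (F : Type*) [Field F] [Fintype F] [DecidableEq F]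
    (hq : 2 < Fintype.card F) (q : ℤ) (hqc : q = Fintype.card F) :
    elC ℤ F * elC ℤ F =
      ((q - 1) ^ 2 * (q - 2)) • (elA ℤ F + elB ℤ F) +
      ((q - 1) * (q - 3) * (q - 4)) • elC ℤ F +
      ((q - 1) * (q - 2) * (q - 3)) • (elDp ℤ F + elDm ℤ F + elEp ℤ F + elEm ℤ F) := by
  ext g
  rw [sq_coeff, pair_card, Finset.card_product, Finset.offDiag_card]
  have hg := g.2
  rw [Matrix.det_fin_two] at hg
  have hc : ((Finset.univ.filter (fun c : F => c ≠ 0)).card : ℤ) = q - 1 := by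
    rw [Finset.filter_ne', Finset.card_erase_of_mem (Finset.mem_univ _), Finset.card_univ, hqc]
    push_cast [Nat.cast_sub (show 1 ≤ Fintype.card F by omega)]
    rfl
  rw [Nat.cast_mul, hc, Nat.cast_sub (Nat.le_mul_self _), Nat.cast_mul, ratios_card, ← hqc]
  simp only [elA, elB, elC, elDp, elDm, elEp, elEm, MonoidAlgebra.coeff_add,
    MonoidAlgebra.coeff_smul, Finsupp.add_apply, Finsupp.smul_apply, suppClass_coeff, suppPat]
  generalize g.1 0 0 = x at *
  generalize g.1 0 1 = y at *
  generalize g.1 1 0 = z at *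
  generalize g.1 1 1 = w at *
  have hne : z ≠ 0 → w ≠ 0 → x / z ≠ y / w := by
    intro hz hw e
    rw [div_eq_div_iff hz hw] at e
    exact zero_ne_one (α := F) (by rw [← hg, e]; ring)
  by_cases hx : x = 0 <;> by_cases hy : y = 0 <;> by_cases hz : z = 0 <;> by_cases hw : w = 0 <;>
    try simp only [hx, hy, hz, hw, mul_zero, zero_mul, sub_zero, zero_ne_one] at hg
  all_goals first
    | (have h3 : ({0, x / z, y / w} : Finset F).card = 3 :=
        Finset.card_eq_three.2 ⟨0, x / z, y / w, (div_ne_zero hx hz).symm,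
          (div_ne_zero hy hw).symm, hne hz hw, rfl⟩
       simp only [h3]
       simp [hx, hy, hz, hw]
       ring)
    | (simp [hx, hy, hz, hw, Finset.card_pair, eq_comm (a := (0 : F))]
       ring)
end

section
/- In ℤ[SL₂(F)] one has D₊·D₋ = E₊² = (q−1)·(C + E₋), and D₋·D₊ = E₋² = (q−1)·(C + E₊). -/
open MonoidAlgebra

lemma aux_mul {G : Type*} [Group G] [Fintype G] [DecidableEq G] (P Q U : G → Prop)
    [DecidablePred P] [DecidablePred Q] [DecidablePred U] (n : ℤ)
    (h1 : ∀ g, U g → ((Finset.univ.filter (fun h => P h ∧ Q (h⁻¹ * g))).card : ℤ) = n)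
    (h0 : ∀ g h, P h → Q (h⁻¹ * g) → U g) :
    (∑ g ∈ Finset.univ.filter P, MonoidAlgebra.of ℤ G g) *
      (∑ g ∈ Finset.univ.filter Q, MonoidAlgebra.of ℤ G g) =
    n • ∑ g ∈ Finset.univ.filter U, MonoidAlgebra.of ℤ G g := by
  have hQ : ∀ h : G, MonoidAlgebra.of ℤ G h * (∑ g ∈ Finset.univ.filter Q, MonoidAlgebra.of ℤ G g)
      = ∑ g, if Q (h⁻¹ * g) then MonoidAlgebra.of ℤ G g else 0 := by
    intro h
    rw [Finset.mul_sum, Finset.sum_filter,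
      ← Equiv.sum_comp (Equiv.mulLeft h) (fun g => if Q (h⁻¹ * g) then MonoidAlgebra.of ℤ G g else 0)]
    refine Finset.sum_congr rfl fun g _ => ?_
    simp only [Equiv.coe_mulLeft, inv_mul_cancel_left, map_mul]
  rw [Finset.sum_mul, Finset.sum_congr rfl (fun h _ => hQ h), Finset.sum_comm, Finset.smul_sum,
    Finset.sum_filter (p := U)]
  refine Finset.sum_congr rfl fun g _ => ?_
  rw [← Finset.sum_filter, Finset.filter_filter, Finset.sum_const]
  split_ifs with hU
  · rw [← h1 g hU, natCast_zsmul]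
  · rw [Finset.filter_false_of_mem]
    · simp
    · rintro h - ⟨hp, hq⟩
      exact hU (h0 g h hp hq)

lemma aux_card {F : Type*} [Field F] [Fintype F] [DecidableEq F] {G : Type*} [Fintype G]
    (P : G → Prop) [DecidablePred P] (f : ∀ x : F, x ≠ 0 → G) (k : G → F)
    (hk : ∀ x hx, k (f x hx) = x) (hf : ∀ x hx, P (f x hx))
    (hs : ∀ g, P g → ∃ hx : k g ≠ 0, f (k g) hx = g) :
    ((Finset.univ.filter P).card : ℤ) = Fintype.card F - 1 := by
  have : Fintype.card Fˣ = (Finset.univ.filter P).card := by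
    rw [← Finset.card_univ]
    refine Finset.card_bij (fun x _ => f x x.ne_zero) ?_ ?_ ?_
    · intro x _; simp [hf]
    · intro x _ y _ h
      ext
      rw [← hk x x.ne_zero, h, hk]
    · intro g hg
      obtain ⟨hx, h⟩ := hs g (by simpa using hg)
      exact ⟨Units.mk0 _ hx, by simp, h⟩
  rw [← this, Fintype.card_units]
  have := Fintype.card_pos (α := F)
  omega

def mkSL {F : Type*} [Field F] (a b c d : F) (h : a * d - b * c = 1) :
    Matrix.SpecialLinearGroup (Fin 2) F := ⟨!![a, b; c, d], by rw [Matrix.det_fin_two_of, h]⟩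

lemma sl_ext {F : Type*} [Field F] (g h : Matrix.SpecialLinearGroup (Fin 2) F)
    (h1 : g.1 0 0 = h.1 0 0) (h2 : g.1 0 1 = h.1 0 1) (h3 : g.1 1 0 = h.1 1 0)
    (h4 : g.1 1 1 = h.1 1 1) : g = h := by
  ext i j
  fin_cases i <;> fin_cases j <;> assumption

lemma sl_det {F : Type*} [Field F] (g : Matrix.SpecialLinearGroup (Fin 2) F) :
    g.1 0 0 * g.1 1 1 - g.1 0 1 * g.1 1 0 = 1 := by
  rw [← Matrix.det_fin_two, g.2]

lemma sl_inv_mul {F : Type*} [Field F] (h g : Matrix.SpecialLinearGroup (Fin 2) F) :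
    (h⁻¹ * g).1 0 0 = h.1 1 1 * g.1 0 0 - h.1 0 1 * g.1 1 0 ∧
    (h⁻¹ * g).1 0 1 = h.1 1 1 * g.1 0 1 - h.1 0 1 * g.1 1 1 ∧
    (h⁻¹ * g).1 1 0 = h.1 0 0 * g.1 1 0 - h.1 1 0 * g.1 0 0 ∧
    (h⁻¹ * g).1 1 1 = h.1 0 0 * g.1 1 1 - h.1 1 0 * g.1 0 1 := by
  have e : (h⁻¹ * g).1 = h.1.adjugate * g.1 := by
    rw [← Matrix.SpecialLinearGroup.coe_inv]; rfl
  rw [e, Matrix.adjugate_fin_two]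
  refine ⟨?_, ?_, ?_, ?_⟩ <;> simp [Matrix.mul_apply, Fin.sum_univ_two] <;> ring

lemma C_add_Em (F : Type*) [Field F] [Fintype F] [DecidableEq F] :
    elC ℤ F + elEm ℤ F = ∑ g ∈ Finset.univ.filter
      (fun g : Matrix.SpecialLinearGroup (Fin 2) F => g.1 0 1 ≠ 0 ∧ g.1 1 0 ≠ 0 ∧ g.1 1 1 ≠ 0),
      MonoidAlgebra.of ℤ (Matrix.SpecialLinearGroup (Fin 2) F) g := by
  unfold elC elEm suppClass
  rw [← Finset.sum_union]
  · congr 1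
    ext g
    simp
    tauto
  · rw [Finset.disjoint_filter]
    simp
    tauto

lemma C_add_Ep (F : Type*) [Field F] [Fintype F] [DecidableEq F] :
    elC ℤ F + elEp ℤ F = ∑ g ∈ Finset.univ.filter
      (fun g : Matrix.SpecialLinearGroup (Fin 2) F => g.1 0 0 ≠ 0 ∧ g.1 0 1 ≠ 0 ∧ g.1 1 0 ≠ 0),
      MonoidAlgebra.of ℤ (Matrix.SpecialLinearGroup (Fin 2) F) g := by
  unfold elC elEp suppClass
  rw [← Finset.sum_union]
  · congr 1
    ext g
    simp
    tauto
  · rw [Finset.disjoint_filter]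
    simp
    tauto

set_option maxHeartbeats 2000000 in
theorem elD_mul_elD (F : Type*) [Field F] [Fintype F] [DecidableEq F]
    (hq : 2 < Fintype.card F) (q : ℤ) (hqc : q = Fintype.card F) :
    elDp ℤ F * elDm ℤ F = (q - 1) • (elC ℤ F + elEm ℤ F) ∧
    elEp ℤ F * elEp ℤ F = (q - 1) • (elC ℤ F + elEm ℤ F) ∧
    elDm ℤ F * elDp ℤ F = (q - 1) • (elC ℤ F + elEp ℤ F) ∧
    elEm ℤ F * elEm ℤ F = (q - 1) • (elC ℤ F + elEp ℤ F) := by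
  rw [C_add_Em, C_add_Ep, hqc]
  unfold elDp elDm elEp elEm suppClass
  refine ⟨?_, ?_, ?_, ?_⟩
  · refine aux_mul _ _ _ _ (fun g hU => ?_) (fun g h hP hQ => ?_)
    · have hg := sl_det g
      obtain ⟨u1, u2, u3⟩ := hU
      refine aux_card _ (fun x hx => mkSL x ((g.1 0 1) / (x * (g.1 1 1))) 0 x⁻¹ (by field_simp; try ring)) (fun h => h.1 0 0) ?_ ?_ ?_
      · intro x hx; simp [mkSL]
      · intro x hx
        obtain ⟨e1, e2, e3, e4⟩ := sl_inv_mul (mkSL x ((g.1 0 1) / (x * (g.1 1 1))) 0 x⁻¹ (by field_simp; try ring)) g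
        rw [e1, e2, e3, e4]
        simp only [mkSL, Matrix.of_apply, Matrix.cons_val', Matrix.cons_val_zero, Matrix.cons_val_one, Matrix.cons_val_fin_one]
        simp only [true_iff, false_iff, reduceCtorEq, not_not]
        grind
      · intro h hPQ
        have hh := sl_det h
        obtain ⟨e1, e2, e3, e4⟩ := sl_inv_mul h g
        rw [e1, e2, e3, e4] at hPQ
        simp only [true_iff, false_iff, reduceCtorEq, not_not] at hPQ
        obtain ⟨⟨a1, a2, a3, a4⟩, b1, b2, b3, b4⟩ := hPQ
        refine ⟨by assumption, ?_⟩
        apply sl_ext <;> simp only [mkSL, Matrix.of_apply, Matrix.cons_val', Matrix.cons_val_zero, Matrix.cons_val_one, Matrix.cons_val_fin_one] <;> grind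
    · have hg := sl_det g
      have hh := sl_det h
      obtain ⟨e1, e2, e3, e4⟩ := sl_inv_mul h g
      rw [e1, e2, e3, e4] at hQ
      simp only [true_iff, false_iff, reduceCtorEq, not_not] at hP hQ
      grind
  · refine aux_mul _ _ _ _ (fun g hU => ?_) (fun g h hP hQ => ?_)
    · have hg := sl_det g
      obtain ⟨u1, u2, u3⟩ := hU
      refine aux_card _ (fun x hx => mkSL (-(g.1 0 1) / (x * (g.1 1 1))) x (-x⁻¹) 0 (by field_simp; try ring)) (fun h => h.1 0 1) ?_ ?_ ?_
      · intro x hx; simp [mkSL]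
      · intro x hx
        obtain ⟨e1, e2, e3, e4⟩ := sl_inv_mul (mkSL (-(g.1 0 1) / (x * (g.1 1 1))) x (-x⁻¹) 0 (by field_simp; try ring)) g
        rw [e1, e2, e3, e4]
        simp only [mkSL, Matrix.of_apply, Matrix.cons_val', Matrix.cons_val_zero, Matrix.cons_val_one, Matrix.cons_val_fin_one]
        simp only [true_iff, false_iff, reduceCtorEq, not_not]
        grind
      · intro h hPQ
        have hh := sl_det h
        obtain ⟨e1, e2, e3, e4⟩ := sl_inv_mul h g
        rw [e1, e2, e3, e4] at hPQ
        simp only [true_iff, false_iff, reduceCtorEq, not_not] at hPQ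
        obtain ⟨⟨a1, a2, a3, a4⟩, b1, b2, b3, b4⟩ := hPQ
        refine ⟨by assumption, ?_⟩
        apply sl_ext <;> simp only [mkSL, Matrix.of_apply, Matrix.cons_val', Matrix.cons_val_zero, Matrix.cons_val_one, Matrix.cons_val_fin_one] <;> grind
    · have hg := sl_det g
      have hh := sl_det h
      obtain ⟨e1, e2, e3, e4⟩ := sl_inv_mul h g
      rw [e1, e2, e3, e4] at hQ
      simp only [true_iff, false_iff, reduceCtorEq, not_not] at hP hQ
      grind
  · refine aux_mul _ _ _ _ (fun g hU => ?_) (fun g h hP hQ => ?_)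
    · have hg := sl_det g
      obtain ⟨u1, u2, u3⟩ := hU
      refine aux_card _ (fun x hx => mkSL x 0 (x * (g.1 1 0) / (g.1 0 0)) x⁻¹ (by field_simp; try ring)) (fun h => h.1 0 0) ?_ ?_ ?_
      · intro x hx; simp [mkSL]
      · intro x hx
        obtain ⟨e1, e2, e3, e4⟩ := sl_inv_mul (mkSL x 0 (x * (g.1 1 0) / (g.1 0 0)) x⁻¹ (by field_simp; try ring)) g
        rw [e1, e2, e3, e4]
        simp only [mkSL, Matrix.of_apply, Matrix.cons_val', Matrix.cons_val_zero, Matrix.cons_val_one, Matrix.cons_val_fin_one]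
        simp only [true_iff, false_iff, reduceCtorEq, not_not]
        grind
      · intro h hPQ
        have hh := sl_det h
        obtain ⟨e1, e2, e3, e4⟩ := sl_inv_mul h g
        rw [e1, e2, e3, e4] at hPQ
        simp only [true_iff, false_iff, reduceCtorEq, not_not] at hPQ
        obtain ⟨⟨a1, a2, a3, a4⟩, b1, b2, b3, b4⟩ := hPQ
        refine ⟨by assumption, ?_⟩
        apply sl_ext <;> simp only [mkSL, Matrix.of_apply, Matrix.cons_val', Matrix.cons_val_zero, Matrix.cons_val_one, Matrix.cons_val_fin_one] <;> grind
    · have hg := sl_det g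
      have hh := sl_det h
      obtain ⟨e1, e2, e3, e4⟩ := sl_inv_mul h g
      rw [e1, e2, e3, e4] at hQ
      simp only [true_iff, false_iff, reduceCtorEq, not_not] at hP hQ
      grind
  · refine aux_mul _ _ _ _ (fun g hU => ?_) (fun g h hP hQ => ?_)
    · have hg := sl_det g
      obtain ⟨u1, u2, u3⟩ := hU
      refine aux_card _ (fun x hx => mkSL 0 x (-x⁻¹) (x * (g.1 1 0) / (g.1 0 0)) (by field_simp; try ring)) (fun h => h.1 0 1) ?_ ?_ ?_
      · intro x hx; simp [mkSL]
      · intro x hx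
        obtain ⟨e1, e2, e3, e4⟩ := sl_inv_mul (mkSL 0 x (-x⁻¹) (x * (g.1 1 0) / (g.1 0 0)) (by field_simp; try ring)) g
        rw [e1, e2, e3, e4]
        simp only [mkSL, Matrix.of_apply, Matrix.cons_val', Matrix.cons_val_zero, Matrix.cons_val_one, Matrix.cons_val_fin_one]
        simp only [true_iff, false_iff, reduceCtorEq, not_not]
        grind
      · intro h hPQ
        have hh := sl_det h
        obtain ⟨e1, e2, e3, e4⟩ := sl_inv_mul h g
        rw [e1, e2, e3, e4] at hPQ
        simp only [true_iff, false_iff, reduceCtorEq, not_not] at hPQ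
        obtain ⟨⟨a1, a2, a3, a4⟩, b1, b2, b3, b4⟩ := hPQ
        refine ⟨by assumption, ?_⟩
        apply sl_ext <;> simp only [mkSL, Matrix.of_apply, Matrix.cons_val', Matrix.cons_val_zero, Matrix.cons_val_one, Matrix.cons_val_fin_one] <;> grind
    · have hg := sl_det g
      have hh := sl_det h
      obtain ⟨e1, e2, e3, e4⟩ := sl_inv_mul h g
      rw [e1, e2, e3, e4] at hQ
      simp only [true_iff, false_iff, reduceCtorEq, not_not] at hP hQ
      grind
end

section
/- Let S be the ℚ-submodule of ℚ[SL₂(F)] spanned by the seven support-class elements A, B, C, D₊, D₋, E₊, E₋. Then S is closed under multiplication, and there exists a ℚ-linear bijection φ from S onto ℚ × ℚ × ℚ × (Matrix (Fin 2) (Fin 2) ℚ) satisfying φ(x·y) = φ(x)·φ(y) for all x, y ∈ S; in particular S is a 7-dimensional semisimple ℚ-algebra isomorphic to ℚ ⊕ ℚ ⊕ ℚ ⊕ M₂(ℚ). -/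
open MonoidAlgebra

set_option linter.unusedSectionVars false
set_option linter.unusedSimpArgs false

section Generic

open Classical in
/-- The sum of the group elements satisfying `P`. -/
noncomputable def sg {G : Type*} [Group G] [Fintype G] (P : G → Prop) : MonoidAlgebra ℚ G :=
  ∑ g ∈ Finset.univ.filter P, MonoidAlgebra.of ℚ G g

open Classical in
/-- The number of the group elements satisfying `P`. -/
noncomputable def cg {G : Type*} [Group G] [Fintype G] (P : G → Prop) : ℚ :=
  ((Finset.univ.filter P).card : ℚ)

open Classical in
lemma coeff_sg {G : Type*} [Group G] [Fintype G] (P : G → Prop) (h : G) :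
    (sg P).coeff h = if P h then 1 else 0 := by
  simp [sg, MonoidAlgebra.of, Finsupp.single_apply, MonoidAlgebra.coeff_sum]

open Classical in
lemma sg_mul_left {G : Type*} [Group G] [Fintype G] {X P Q : G → Prop}
    (H : ∀ h, X h → ∀ g, P g ↔ Q (h * g)) : sg X * sg P = cg X • sg Q := by
  have key : ∀ h, X h → MonoidAlgebra.of ℚ G h * sg P = sg Q := by
    intro h hh
    unfold sg
    rw [Finset.mul_sum]
    refine Finset.sum_bij (fun g _ => h * g) ?_ ?_ ?_ ?_
    · intro g hg
      simpa using (H h hh g).1 (by simpa using hg)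
    · intro g _ g' _ e
      exact mul_left_cancel e
    · intro g hg
      refine ⟨h⁻¹ * g, ?_, by simp⟩
      simpa [H h hh] using hg
    · intro g _
      rw [map_mul]
  unfold cg
  conv_lhs => rw [sg, Finset.sum_mul]
  rw [Finset.sum_congr rfl (fun h hh => key h (by simpa using hh)), Finset.sum_const]
  rw [Nat.cast_smul_eq_nsmul]

open Classical in
lemma sg_mul_right {G : Type*} [Group G] [Fintype G] {X P Q : G → Prop}
    (H : ∀ h, X h → ∀ g, P g ↔ Q (g * h)) : sg P * sg X = cg X • sg Q := by
  have key : ∀ h, X h → sg P * MonoidAlgebra.of ℚ G h = sg Q := by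
    intro h hh
    unfold sg
    rw [Finset.sum_mul]
    refine Finset.sum_bij (fun g _ => g * h) ?_ ?_ ?_ ?_
    · intro g hg
      simpa using (H h hh g).1 (by simpa using hg)
    · intro g _ g' _ e
      exact mul_right_cancel e
    · intro g hg
      refine ⟨g * h⁻¹, ?_, by simp⟩
      simpa [H h hh] using hg
    · intro g _
      rw [map_mul]
  unfold cg
  have e : sg P * sg X = ∑ h ∈ Finset.univ.filter X, sg P * MonoidAlgebra.of ℚ G h := by
    rw [← Finset.mul_sum, sg, sg]
  rw [e, Finset.sum_congr rfl (fun h hh => key h (by simpa using hh)), Finset.sum_const]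
  rw [Nat.cast_smul_eq_nsmul]

open Classical in
lemma coeff_sg_mul {G : Type*} [Group G] [Fintype G] (P X : G → Prop) (g : G) :
    (sg P * sg X).coeff g = cg (fun h => X h ∧ P (g * h⁻¹)) := by
  have : (sg P * sg X).coeff g
      = ∑ h ∈ Finset.univ.filter X, (sg P * MonoidAlgebra.of ℚ G h).coeff g := by
    conv_lhs => rw [sg, sg, Finset.mul_sum]
    simp only [MonoidAlgebra.coeff_sum, Finsupp.coe_finsetSum, Finset.sum_apply]
    rfl
  rw [this]
  have h2 : ∀ h : G, (sg P * MonoidAlgebra.of ℚ G h).coeff g = if P (g * h⁻¹) then 1 else 0 := by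
    intro h
    rw [← coeff_sg]
    simp [MonoidAlgebra.of]
  simp only [h2, cg, Finset.sum_boole, Finset.filter_filter]
  congr

open Classical in
lemma cg_mul_right {G : Type*} [Group G] [Fintype G] (X : G → Prop) (h₀ : G) :
    cg (fun h => X (h * h₀)) = cg X := by
  unfold cg
  congr 1
  refine Finset.card_bij (fun h _ => h * h₀) ?_ ?_ ?_
  · intro h hh
    simpa using hh
  · intro g _ g' _ e
    exact mul_right_cancel e
  · intro g hg
    exact ⟨g * h₀⁻¹, by simpa using hg, by simp⟩

open Classical in
lemma cg_pos {G : Type*} [Group G] [Fintype G] {X : G → Prop} (g : G) (hg : X g) : 0 < cg X := by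
  unfold cg
  have : 0 < (Finset.univ.filter X).card := Finset.card_pos.2 ⟨g, by simpa using hg⟩
  exact_mod_cast this

open Classical in
lemma cg_lt {G : Type*} [Group G] [Fintype G] {X Y : G → Prop} (hXY : ∀ g, X g → Y g) (g : G)
    (hg : Y g) (hg' : ¬ X g) : cg X < cg Y := by
  unfold cg
  have : (Finset.univ.filter X).card < (Finset.univ.filter Y).card := by
    apply Finset.card_lt_card
    rw [Finset.ssubset_iff_of_subset]
    · exact ⟨g, by simpa using hg, by simpa using hg'⟩
    · intro x hx
      simpa using hXY x (by simpa using hx)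
  exact_mod_cast this

end Generic

section Abstract

/-- The parametrization of the algebra by seven coordinates. -/
noncomputable def rho {R : Type*} [Ring R] [Algebra ℚ R] (a b p g : R) : (Fin 7 → ℚ) →ₗ[ℚ] R where
  toFun c := c 0 • a + c 1 • b + c 2 • p + c 3 • (p * b) + c 4 • (b * p) + c 5 • (b * p * b)
    + c 6 • g
  map_add' c d := by simp only [Pi.add_apply]; module
  map_smul' t c := by simp only [Pi.smul_apply, smul_eq_mul, RingHom.id_apply]; module

/-- The structure constants. -/
def mu (r : ℚ) (c d : Fin 7 → ℚ) : Fin 7 → ℚ :=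
  ![c 0 * d 0 + c 1 * d 1,
    c 0 * d 1 + c 1 * d 0,
    c 0 * d 2 + c 1 * d 4 + c 2 * d 0 + c 2 * d 2 - r * c 2 * d 4 + c 3 * d 1 - r * c 3 * d 2
      + c 3 * d 4,
    c 0 * d 3 + c 1 * d 5 + c 2 * d 1 + c 2 * d 3 - r * c 2 * d 5 + c 3 * d 0 - r * c 3 * d 3
      + c 3 * d 5,
    c 0 * d 4 + c 1 * d 2 + c 4 * d 0 + c 4 * d 2 - r * c 4 * d 4 + c 5 * d 1 - r * c 5 * d 2
      + c 5 * d 4,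
    c 0 * d 5 + c 1 * d 3 + c 4 * d 1 + c 4 * d 3 - r * c 4 * d 5 + c 5 * d 0 - r * c 5 * d 3
      + c 5 * d 5,
    c 6 * (d 0 + d 1 + d 2 + d 3 + d 4 + d 5 + d 6)
      + (c 0 + c 1 + c 2 + c 3 + c 4 + c 5) * d 6
      + (1 + r) * ((c 2 + c 4) * (d 4 + d 5) + (c 3 + c 5) * (d 2 + d 3))]

lemma rho_mul {R : Type*} [Ring R] [Algebra ℚ R] (a b p g : R) (r : ℚ)
    (aa : a * a = a) (ab : a * b = b) (ba : b * a = b) (ap : a * p = p) (pa : p * a = p)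
    (ag : a * g = g) (ga : g * a = g) (bb : b * b = a) (bg : b * g = g) (gb : g * b = g)
    (pp : p * p = p) (pg : p * g = g) (gp : g * p = g) (gg : g * g = g)
    (pbp : p * b * p = (1 + r) • g - r • p) (c d : Fin 7 → ℚ) :
    rho a b p g c * rho a b p g d = rho a b p g (mu r c d) := by
  have ab' : ∀ x, a * (b * x) = b * x := fun x => by rw [← mul_assoc, ab]
  have ap' : ∀ x, a * (p * x) = p * x := fun x => by rw [← mul_assoc, ap]
  have bb' : ∀ x, b * (b * x) = a * x := fun x => by rw [← mul_assoc, bb]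
  have pp' : ∀ x, p * (p * x) = p * x := fun x => by rw [← mul_assoc, pp]
  have gb' : ∀ x, g * (b * x) = g * x := fun x => by rw [← mul_assoc, gb]
  have gp' : ∀ x, g * (p * x) = g * x := fun x => by rw [← mul_assoc, gp]
  have pbp1 : p * (b * p) = (1 + r) • g - r • p := by rw [← mul_assoc, pbp]
  have pbp' : ∀ x, p * (b * (p * x)) = (1 + r) • (g * x) - r • (p * x) := fun x => by
    rw [← mul_assoc b, ← mul_assoc, pbp1, sub_mul, smul_mul_assoc, smul_mul_assoc]
  simp only [rho, LinearMap.coe_mk, AddHom.coe_mk, mu, add_mul, mul_add, smul_mul_assoc,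
    mul_smul_comm, mul_assoc, aa, ab, ba, ap, pa, ag, ga, bb, bg, gb, pp, pg, gp, gg,
    ab', ap', bb', pp', gb', gp', pbp1, pbp', mul_sub]
  simp only [Matrix.cons_val]
  module

/-- The seven coordinates mapped to the semisimple algebra. -/
noncomputable def phi (r : ℚ) : (Fin 7 → ℚ) →ₗ[ℚ] ℚ × ℚ × ℚ × Matrix (Fin 2) (Fin 2) ℚ where
  toFun c := (c 0 + c 1 + c 2 + c 3 + c 4 + c 5 + c 6, c 0 + c 1, c 0 - c 1,
    !![c 0 - r * c 1 + c 2 - r * c 3 - r * c 4 + r ^ 2 * c 5, c 1 + c 3 - r * c 5;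
      (1 - r ^ 2) * (c 1 + c 4 - r * c 5), c 0 + r * c 1 + (1 - r ^ 2) * c 5])
  map_add' c d := by
    ext i j
    · simp; ring
    · simp; ring
    · simp; ring
    · fin_cases i <;> fin_cases j <;> simp <;> ring
  map_smul' t c := by
    ext i j
    · simp; ring
    · simp; ring
    · simp; ring
    · fin_cases i <;> fin_cases j <;> simp <;> ring

lemma phi_mul (r : ℚ) (c d : Fin 7 → ℚ) : phi r (mu r c d) = phi r c * phi r d := by
  ext i j
  · simp [phi, mu]; ring
  · simp [phi, mu]; ring
  · simp [phi, mu]; ring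
  · fin_cases i <;> fin_cases j <;> simp [phi, mu, Matrix.mul_apply, Fin.sum_univ_two] <;> ring

lemma phi_bij (r : ℚ) (hr : 1 - r ^ 2 ≠ 0) : Function.Bijective (phi r) := by
  have hinj : Function.Injective (phi r) := by
    rw [injective_iff_map_eq_zero]
    intro c hc
    have h1 := congrArg (fun x => x.1) hc
    have h2 := congrArg (fun x => x.2.1) hc
    have h3 := congrArg (fun x => x.2.2.1) hc
    have h4 := congrArg (fun x => x.2.2.2 0 0) hc
    have h5 := congrArg (fun x => x.2.2.2 0 1) hc
    have h6 := congrArg (fun x => x.2.2.2 1 0) hc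
    have h7 := congrArg (fun x => x.2.2.2 1 1) hc
    simp [phi] at h1 h2 h3 h4 h5 h6 h7
    have e0 : c 0 = 0 := by linarith
    have e1 : c 1 = 0 := by linarith
    have e5 : c 5 = 0 := by
      simp only [e0, e1, mul_zero, zero_add, mul_eq_zero] at h7
      exact h7.resolve_left hr
    have e3 : c 3 = 0 := by simpa [e1, e5] using h5
    have e4 : c 4 = 0 := by
      have := h6.resolve_left hr
      simpa [e1, e5] using this
    have e2 : c 2 = 0 := by simpa [e0, e1, e3, e4, e5] using h4
    have e6 : c 6 = 0 := by simpa [e0, e1, e2, e3, e4, e5] using h1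
    funext i
    fin_cases i <;> assumption
  refine ⟨hinj, ?_⟩
  refine (LinearMap.injective_iff_surjective_of_finrank_eq_finrank ?_).1 hinj
  simp [Module.finrank_matrix]

end Abstract

section Concrete

variable {F : Type*} [Field F] [Fintype F] [DecidableEq F]

local notation "SL" => Matrix.SpecialLinearGroup (Fin 2) F

/-- Diagonal. -/
def pT (g : Matrix.SpecialLinearGroup (Fin 2) F) : Prop := g.1 0 1 = 0 ∧ g.1 1 0 = 0
/-- Antidiagonal. -/
def pW (g : Matrix.SpecialLinearGroup (Fin 2) F) : Prop := g.1 0 0 = 0 ∧ g.1 1 1 = 0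
/-- Upper triangular. -/
def pU (g : Matrix.SpecialLinearGroup (Fin 2) F) : Prop := g.1 1 0 = 0
/-- Entry 2,2 zero. -/
def pUW (g : Matrix.SpecialLinearGroup (Fin 2) F) : Prop := g.1 1 1 = 0
/-- Entry 1,1 zero. -/
def pWU (g : Matrix.SpecialLinearGroup (Fin 2) F) : Prop := g.1 0 0 = 0
/-- Lower triangular. -/
def pL (g : Matrix.SpecialLinearGroup (Fin 2) F) : Prop := g.1 0 1 = 0
/-- All. -/
def pG (_ : Matrix.SpecialLinearGroup (Fin 2) F) : Prop := True

lemma det_eq (g : SL) : g.1 0 0 * g.1 1 1 - g.1 0 1 * g.1 1 0 = 1 := by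
  have := g.2
  rwa [Matrix.det_fin_two] at this

lemma m00 (g h : SL) : (g * h).1 0 0 = g.1 0 0 * h.1 0 0 + g.1 0 1 * h.1 1 0 := by
  simp [Matrix.mul_apply, Fin.sum_univ_two]
lemma m01 (g h : SL) : (g * h).1 0 1 = g.1 0 0 * h.1 0 1 + g.1 0 1 * h.1 1 1 := by
  simp [Matrix.mul_apply, Fin.sum_univ_two]
lemma m10 (g h : SL) : (g * h).1 1 0 = g.1 1 0 * h.1 0 0 + g.1 1 1 * h.1 1 0 := by
  simp [Matrix.mul_apply, Fin.sum_univ_two]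
lemma m11 (g h : SL) : (g * h).1 1 1 = g.1 1 0 * h.1 0 1 + g.1 1 1 * h.1 1 1 := by
  simp [Matrix.mul_apply, Fin.sum_univ_two]

lemma rTT (h : SL) (hh : pT h) (g : SL) : pT g ↔ pT (h * g) := by
  have h1 := det_eq h; have h2 := det_eq g
  simp only [pT, m00, m01, m10, m11] at *; grind
lemma rTW (h : SL) (hh : pT h) (g : SL) : pW g ↔ pW (h * g) := by
  have h1 := det_eq h; have h2 := det_eq g
  simp only [pT, pW, m00, m01, m10, m11] at *; grind
lemma rWT (h : SL) (hh : pT h) (g : SL) : pW g ↔ pW (g * h) := by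
  have h1 := det_eq h; have h2 := det_eq g
  simp only [pT, pW, m00, m01, m10, m11] at *; grind
lemma rWW (h : SL) (hh : pW h) (g : SL) : pW g ↔ pT (h * g) := by
  have h1 := det_eq h; have h2 := det_eq g
  simp only [pT, pW, m00, m01, m10, m11] at *; grind
lemma rTU (h : SL) (hh : pT h) (g : SL) : pU g ↔ pU (h * g) := by
  have h1 := det_eq h; have h2 := det_eq g
  simp only [pT, pU, m00, m01, m10, m11] at *; grind
lemma rUT (h : SL) (hh : pT h) (g : SL) : pU g ↔ pU (g * h) := by
  have h1 := det_eq h; have h2 := det_eq g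
  simp only [pT, pU, m00, m01, m10, m11] at *; grind
lemma rUU (h : SL) (hh : pU h) (g : SL) : pU g ↔ pU (h * g) := by
  have h1 := det_eq h; have h2 := det_eq g
  simp only [pT, pU, m00, m01, m10, m11] at *; grind
lemma rUW (h : SL) (hh : pW h) (g : SL) : pU g ↔ pUW (g * h) := by
  have h1 := det_eq h; have h2 := det_eq g
  simp only [pT, pU, pW, pUW, m00, m01, m10, m11] at *; grind
lemma rWU (h : SL) (hh : pW h) (g : SL) : pU g ↔ pWU (h * g) := by
  have h1 := det_eq h; have h2 := det_eq g
  simp only [pT, pU, pW, pWU, m00, m01, m10, m11] at *; grind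
lemma rWUW (h : SL) (hh : pW h) (g : SL) : pWU g ↔ pL (g * h) := by
  have h1 := det_eq h; have h2 := det_eq g
  simp only [pT, pU, pW, pWU, pL, m00, m01, m10, m11] at *; grind

/-- The upper unipotent matrix. -/
def upper (x : F) : SL := ⟨!![1, x; 0, 1], by simp [Matrix.det_fin_two]⟩

lemma UWU : sg (pUW (F := F)) * sg (pU (F := F)) = cg (pT (F := F)) • (sg pG - sg (pU (F := F))) := by
  classical
  ext g
  rw [coeff_sg_mul]
  simp only [MonoidAlgebra.coeff_smul, MonoidAlgebra.coeff_sub, Finsupp.smul_apply,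
    Finsupp.sub_apply, coeff_sg, smul_eq_mul]
  have hg := det_eq g
  have hinv : ∀ h : SL, (h⁻¹).1 0 1 = - h.1 0 1 ∧ (h⁻¹).1 1 1 = h.1 0 0 := by
    intro h
    rw [Matrix.SpecialLinearGroup.SL2_inv_expl]
    simp
  by_cases hu : pU g
  · have : (fun h : SL => pU h ∧ pUW (g * h⁻¹)) = fun _ => False := by
      funext h
      have h1 := det_eq h
      have h2 := hinv h
      simp only [pU, pUW, m11, h2.1, h2.2] at *
      grind
    rw [this]
    simp [hu, cg, pG]
  · rw [← cg_mul_right pT (upper (-(g.1 1 1 / g.1 1 0)))]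
    rw [if_pos (show pG g from trivial), if_neg hu, sub_zero, mul_one]
    congr 1
    funext h
    have h1 := det_eq h
    have h2 := hinv h
    clear hinv
    have hup : ∀ x : F, (upper x).1 0 0 = 1 ∧ (upper x).1 0 1 = x ∧ (upper x).1 1 0 = 0 ∧
        (upper x).1 1 1 = 1 := by
      intro x
      simp [upper]
    simp only [pU, pUW, pT, m00, m01, m10, m11, h2.1, h2.2, (hup _).1, (hup _).2.1,
      (hup _).2.2.1, (hup _).2.2.2] at hu ⊢
    clear h2 hup
    generalize g.1 1 1 = z at *
    generalize g.1 1 0 = y at *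
    generalize h.1 0 0 = h00 at *
    generalize h.1 0 1 = h01 at *
    generalize h.1 1 0 = h10 at *
    generalize h.1 1 1 = h11 at *
    apply propext
    constructor
    · rintro ⟨rfl, h3⟩
      refine ⟨?_, by ring⟩
      field_simp
      linear_combination -h3
    · rintro ⟨h3, h4⟩
      have h5 : h10 = 0 := by simpa using h4
      refine ⟨h5, ?_⟩
      field_simp at h3
      linear_combination -h3

lemma cgW : cg (pW (F := F)) = cg (pT (F := F)) := by
  obtain ⟨w, w00, w01, w10, w11⟩ : ∃ w : SL, w.1 0 0 = 0 ∧ w.1 0 1 = 1 ∧ w.1 1 0 = -1 ∧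
      w.1 1 1 = 0 :=
    ⟨⟨!![0, 1; -1, 0], by simp [Matrix.det_fin_two]⟩, by simp⟩
  rw [← cg_mul_right pT w]
  congr 1
  funext h
  simp only [pW, pT, m01, m10, w00, w01, w10, w11]
  simp

lemma coeff_suppClass (b₁ b₂ b₃ b₄ : Bool) (g : SL) :
    (suppClass ℚ F b₁ b₂ b₃ b₄).coeff g = if ((b₁ = true ↔ g.1 0 0 ≠ 0) ∧ (b₂ = true ↔ g.1 0 1 ≠ 0) ∧
      (b₃ = true ↔ g.1 1 0 ≠ 0) ∧ (b₄ = true ↔ g.1 1 1 ≠ 0)) then 1 else 0 := by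
  simp [suppClass, MonoidAlgebra.of, Finsupp.single_apply, MonoidAlgebra.coeff_sum]

lemma elA_eq : elA ℚ F = sg pT := by
  ext g
  rw [coeff_sg, elA, coeff_suppClass]
  have := det_eq g
  simp only [pT]
  congr 1
  simp
  grind

lemma elB_eq : elB ℚ F = sg pW := by
  ext g
  rw [coeff_sg, elB, coeff_suppClass]
  have := det_eq g
  simp only [pW]
  congr 1
  simp
  grind

lemma elDp_eq : elDp ℚ F = sg pU - sg pT := by
  ext g
  rw [MonoidAlgebra.coeff_sub, Finsupp.sub_apply, coeff_sg, coeff_sg, elDp, coeff_suppClass]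
  have := det_eq g
  simp only [pU, pT, ne_eq, true_iff, false_iff, Bool.false_eq_true, not_not]
  split_ifs <;> grind

lemma elDm_eq : elDm ℚ F = sg pL - sg pT := by
  ext g
  rw [MonoidAlgebra.coeff_sub, Finsupp.sub_apply, coeff_sg, coeff_sg, elDm, coeff_suppClass]
  have := det_eq g
  simp only [pL, pT, ne_eq, true_iff, false_iff, Bool.false_eq_true, not_not]
  split_ifs <;> grind

lemma elEp_eq : elEp ℚ F = sg pUW - sg pW := by
  ext g
  rw [MonoidAlgebra.coeff_sub, Finsupp.sub_apply, coeff_sg, coeff_sg, elEp, coeff_suppClass]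
  have := det_eq g
  simp only [pUW, pW, ne_eq, true_iff, false_iff, Bool.false_eq_true, not_not]
  split_ifs <;> grind

lemma elEm_eq : elEm ℚ F = sg pWU - sg pW := by
  ext g
  rw [MonoidAlgebra.coeff_sub, Finsupp.sub_apply, coeff_sg, coeff_sg, elEm, coeff_suppClass]
  have := det_eq g
  simp only [pWU, pW, ne_eq, true_iff, false_iff, Bool.false_eq_true, not_not]
  split_ifs <;> grind

lemma elC_eq : elC ℚ F = sg pG - sg pU - sg pL - sg pUW - sg pWU + sg pT + sg pW := by
  ext g
  simp only [MonoidAlgebra.coeff_sub, Finsupp.sub_apply, MonoidAlgebra.coeff_add,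
    Finsupp.add_apply, coeff_sg]
  rw [elC, coeff_suppClass]
  have := det_eq g
  simp only [pG, pU, pL, pUW, pWU, pW, pT, ne_eq, true_iff]
  by_cases h1 : g.1 0 0 = 0 <;> by_cases h2 : g.1 0 1 = 0 <;> by_cases h3 : g.1 1 0 = 0 <;>
    by_cases h4 : g.1 1 1 = 0 <;> simp_all

end Concrete

/-- A three-term criterion used to close the structure theorem. -/
lemma finish {V : Type*} [Ring V] [Algebra ℚ V] (S : Submodule ℚ V) (f : (Fin 7 → ℚ) →ₗ[ℚ] V)
    (hf : Function.Injective f) (hS : S = LinearMap.range f) (r : ℚ) (hr : 1 - r ^ 2 ≠ 0)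
    (hmul : ∀ c d, f c * f d = f (mu r c d)) :
    (∀ x ∈ S, ∀ y ∈ S, x * y ∈ S) ∧
    ∃ φ : S →ₗ[ℚ] ℚ × ℚ × ℚ × Matrix (Fin 2) (Fin 2) ℚ,
      Function.Bijective φ ∧
      ∀ (x y : V) (hx : x ∈ S) (hy : y ∈ S) (hxy : x * y ∈ S),
        φ ⟨x * y, hxy⟩ = φ ⟨x, hx⟩ * φ ⟨y, hy⟩ := by
  subst hS
  refine ⟨?_, ?_⟩
  · rintro _ ⟨c, rfl⟩ _ ⟨d, rfl⟩
    exact ⟨_, (hmul c d).symm⟩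
  · have key : ∀ c (h : f c ∈ LinearMap.range f),
        (LinearEquiv.ofInjective f hf).symm ⟨f c, h⟩ = c := by
      intro c h
      rw [LinearEquiv.symm_apply_eq]
      rfl
    refine ⟨(phi r).comp (LinearEquiv.ofInjective f hf).symm.toLinearMap, ?_, ?_⟩
    · exact (phi_bij r hr).comp (LinearEquiv.ofInjective f hf).symm.bijective
    · rintro _ _ ⟨c, rfl⟩ ⟨d, rfl⟩ hxy
      have h1 := key (mu r c d) ⟨_, rfl⟩
      simp only [LinearMap.comp_apply, LinearEquiv.coe_coe, hmul, h1, phi_mul]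
      rw [key c ⟨_, rfl⟩, key d ⟨_, rfl⟩]

set_option maxHeartbeats 4000000 in
theorem SC_semisimple_structure (F : Type*) [Field F] [Fintype F] [DecidableEq F]
    (hq : 2 < Fintype.card F)
    (S : Submodule ℚ (MonoidAlgebra ℚ (Matrix.SpecialLinearGroup (Fin 2) F)))
    (hS : S = Submodule.span ℚ ({elA ℚ F, elB ℚ F, elC ℚ F, elDp ℚ F, elDm ℚ F, elEp ℚ F, elEm ℚ F} : Set (MonoidAlgebra ℚ (Matrix.SpecialLinearGroup (Fin 2) F)))) :
    (∀ x ∈ S, ∀ y ∈ S, x * y ∈ S) ∧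
    ∃ φ : S →ₗ[ℚ] ℚ × ℚ × ℚ × Matrix (Fin 2) (Fin 2) ℚ,
      Function.Bijective φ ∧
      ∀ (x y : MonoidAlgebra ℚ (Matrix.SpecialLinearGroup (Fin 2) F)) (hx : x ∈ S) (hy : y ∈ S) (hxy : x * y ∈ S),
        φ ⟨x * y, hxy⟩ = φ ⟨x, hx⟩ * φ ⟨y, hy⟩ := by
  
  have hn : 0 < cg (pT (F := F)) := cg_pos 1 (by simp [pT])
  have hN : 0 < cg (pU (F := F)) := cg_pos 1 (by simp [pU])
  have hM : 0 < cg (pG (F := F)) := cg_pos 1 trivial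
  have hlt : cg (pT (F := F)) < cg (pU (F := F)) :=
    cg_lt (fun g hg => hg.2) (upper 1) (by simp [pU, upper]) (by simp [pT, upper])
  have TT := sg_mul_left (rTT (F := F))
  have TW := sg_mul_left (rTW (F := F))
  have WT := sg_mul_right (rWT (F := F))
  have WW := sg_mul_left (rWW (F := F))
  have TU := sg_mul_left (rTU (F := F))
  have UT := sg_mul_right (rUT (F := F))
  have UU := sg_mul_left (rUU (F := F))
  have UW := sg_mul_right (rUW (F := F))
  have WU := sg_mul_left (rWU (F := F))
  have WUW := sg_mul_right (rWUW (F := F))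
  have XG : ∀ X : Matrix.SpecialLinearGroup (Fin 2) F → Prop, sg X * sg pG = cg X • sg pG :=
    fun X => sg_mul_left (fun _ _ _ => Iff.rfl)
  have GX : ∀ X : Matrix.SpecialLinearGroup (Fin 2) F → Prop, sg pG * sg X = cg X • sg pG :=
    fun X => sg_mul_right (fun _ _ _ => Iff.rfl)
  have UWU' := UWU (F := F)
  rw [cgW] at WW UW WU WUW
  have XGW := XG pW
  have GXW := GX pW
  rw [cgW] at XGW GXW
  have XGT := XG pT
  have GXT := GX pT
  have XGU := XG pU
  have GXU := GX pU
  have GG := GX pG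
  set n := cg (pT (F := F)) with hn_def
  set N := cg (pU (F := F)) with hN_def
  set M := cg (pG (F := F)) with hM_def
  have hn0 := hn.ne'
  have hN0 := hN.ne'
  have hM0 := hM.ne'
  obtain ⟨a, ha⟩ : ∃ a, a = n⁻¹ • sg (pT (F := F)) := ⟨_, rfl⟩
  obtain ⟨b, hb⟩ : ∃ b, b = n⁻¹ • sg (pW (F := F)) := ⟨_, rfl⟩
  obtain ⟨p, hp⟩ : ∃ p, p = N⁻¹ • sg (pU (F := F)) := ⟨_, rfl⟩
  obtain ⟨g, hg⟩ : ∃ g, g = M⁻¹ • sg (pG (F := F)) := ⟨_, rfl⟩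
  have pb : p * b = N⁻¹ • sg (pUW (F := F)) := by
    rw [hp, hb, smul_mul_smul_comm, UW, smul_smul]; congr 1; field_simp
  have bp : b * p = N⁻¹ • sg (pWU (F := F)) := by
    rw [hp, hb, smul_mul_smul_comm, WU, smul_smul]; congr 1; field_simp
  have bpb : b * p * b = N⁻¹ • sg (pL (F := F)) := by
    rw [bp, hb, smul_mul_smul_comm, WUW, smul_smul]; congr 1; field_simp
  have bg : b * g = g := by
    rw [hg, hb, smul_mul_smul_comm, XGW, smul_smul]; congr 1; field_simp
  have pg : p * g = g := by
    rw [hg, hp, smul_mul_smul_comm, XGU, smul_smul]; congr 1; field_simp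
  have gg : g * g = g := by
    rw [hg, smul_mul_smul_comm, GG, smul_smul]; congr 1; field_simp
  have g0 : g ≠ 0 := by
    intro h
    have h1 := congrArg (fun x => x.coeff 1) h
    rw [hg] at h1
    simp [coeff_sg, pG, hM0] at h1
  have pbp0 : p * b * p = (n * M / N ^ 2) • g - (n / N) • p := by
    rw [pb, hp, hg, smul_mul_smul_comm, UWU', smul_smul, smul_smul, smul_smul, smul_sub]
    have e1 : N⁻¹ * N⁻¹ * n = n * M / N ^ 2 * M⁻¹ := by field_simp
    have e2 : N⁻¹ * N⁻¹ * n = n / N * N⁻¹ := by field_simp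
    rw [← e1, ← e2]
  have hk : n * M / N ^ 2 = 1 + n / N := by
    have h1 : p * b * p * g = (n * M / N ^ 2 - n / N) • g := by
      rw [pbp0, sub_mul, smul_mul_assoc, smul_mul_assoc, gg, pg, sub_smul]
    rw [mul_assoc, pg, mul_assoc, bg, pg] at h1
    have h2 : (n * M / N ^ 2 - n / N - 1) • g = 0 := by rw [sub_smul, ← h1, one_smul, sub_self]
    have h3 := (smul_eq_zero.1 h2).resolve_right g0
    linarith
  rw [hk] at pbp0
  refine finish S (rho a b p g) ?_ ?_ (n / N) ?_ ?_
  · -- injectivity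
    rw [injective_iff_map_eq_zero]
    intro c hc
    obtain ⟨t, ht0, ht1⟩ : ∃ t : F, t ≠ 0 ∧ t ≠ 1 := by
      obtain ⟨t, ht⟩ := Finset.exists_mem_notMem_of_card_lt_card
        (s := ({0, 1} : Finset F)) (t := Finset.univ)
        (lt_of_le_of_lt Finset.card_le_two (by simpa using hq))
      exact ⟨t, by simpa using ht⟩
    have ht2 : t - 1 ≠ 0 := sub_ne_zero.2 ht1
    simp only [rho, LinearMap.coe_mk, AddHom.coe_mk] at hc
    rw [bpb, pb, bp, ha, hb, hp, hg] at hc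
    have ev := fun (x : Matrix.SpecialLinearGroup (Fin 2) F) => congrArg (fun y => y.coeff x) hc
    simp only [MonoidAlgebra.coeff_add, MonoidAlgebra.coeff_smul, Finsupp.add_apply,
      Finsupp.smul_apply, coeff_sg, pT, pW, pU, pL, pUW, pWU, pG, smul_eq_mul,
      MonoidAlgebra.coeff_zero, Finsupp.coe_zero, Pi.zero_apply] at ev
    have v1 := ev ⟨!![t, 1; t - 1, 1], by simp [Matrix.det_fin_two]⟩
    have v2 := ev ⟨!![1, 1; 0, 1], by simp [Matrix.det_fin_two]⟩
    have v3 := ev ⟨!![1, 0; 1, 1], by simp [Matrix.det_fin_two]⟩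
    have v4 := ev ⟨!![1, 1; -1, 0], by simp [Matrix.det_fin_two]⟩
    have v5 := ev ⟨!![0, 1; -1, 1], by simp [Matrix.det_fin_two]⟩
    have v6 := ev ⟨!![1, 0; 0, 1], by simp [Matrix.det_fin_two]⟩
    have v7 := ev ⟨!![0, 1; -1, 0], by simp [Matrix.det_fin_two]⟩
    simp [ht0, ht2, hM0] at v1
    simp [v1, hN0] at v2 v3 v4 v5
    simp [v1, v2, v3, v4, v5, hn0] at v6 v7
    funext i
    fin_cases i <;> assumption
  · -- range
    have hR : ∀ c, rho a b p g c ∈ LinearMap.range (rho a b p g) := fun c => ⟨c, rfl⟩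
    rw [hS]
    apply le_antisymm
    · rw [Submodule.span_le]
      have eT : sg (pT (F := F)) = n • a := by rw [ha, smul_smul, mul_inv_cancel₀ hn0, one_smul]
      have eW : sg (pW (F := F)) = n • b := by rw [hb, smul_smul, mul_inv_cancel₀ hn0, one_smul]
      have eU : sg (pU (F := F)) = N • p := by rw [hp, smul_smul, mul_inv_cancel₀ hN0, one_smul]
      have eG : sg (pG (F := F)) = M • g := by rw [hg, smul_smul, mul_inv_cancel₀ hM0, one_smul]
      have eUW : sg (pUW (F := F)) = N • (p * b) := by
        rw [pb, smul_smul, mul_inv_cancel₀ hN0, one_smul]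
      have eWU : sg (pWU (F := F)) = N • (b * p) := by
        rw [bp, smul_smul, mul_inv_cancel₀ hN0, one_smul]
      have eL : sg (pL (F := F)) = N • (b * p * b) := by
        rw [bpb, smul_smul, mul_inv_cancel₀ hN0, one_smul]
      have mT : a ∈ LinearMap.range (rho a b p g) := ⟨![1, 0, 0, 0, 0, 0, 0], by simp [rho]⟩
      have mW : b ∈ LinearMap.range (rho a b p g) := ⟨![0, 1, 0, 0, 0, 0, 0], by simp [rho]⟩
      have mU : p ∈ LinearMap.range (rho a b p g) := ⟨![0, 0, 1, 0, 0, 0, 0], by simp [rho]⟩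
      have mUW : p * b ∈ LinearMap.range (rho a b p g) := ⟨![0, 0, 0, 1, 0, 0, 0], by simp [rho]⟩
      have mWU : b * p ∈ LinearMap.range (rho a b p g) := ⟨![0, 0, 0, 0, 1, 0, 0], by simp [rho]⟩
      have mL : b * p * b ∈ LinearMap.range (rho a b p g) :=
        ⟨![0, 0, 0, 0, 0, 1, 0], by simp [rho]⟩
      have mG : g ∈ LinearMap.range (rho a b p g) := ⟨![0, 0, 0, 0, 0, 0, 1], by simp [rho]⟩
      generalize LinearMap.range (rho a b p g) = Z at *
      replace mT : sg pT ∈ Z := eT ▸ Z.smul_mem n mT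
      replace mW : sg pW ∈ Z := eW ▸ Z.smul_mem n mW
      replace mU : sg pU ∈ Z := eU ▸ Z.smul_mem N mU
      replace mG : sg pG ∈ Z := eG ▸ Z.smul_mem M mG
      replace mUW : sg pUW ∈ Z := eUW ▸ Z.smul_mem N mUW
      replace mWU : sg pWU ∈ Z := eWU ▸ Z.smul_mem N mWU
      replace mL : sg pL ∈ Z := eL ▸ Z.smul_mem N mL
      rintro x (rfl | rfl | rfl | rfl | rfl | rfl | rfl)
      · rw [elA_eq]; exact mT
      · rw [elB_eq]; exact mW
      · rw [elC_eq]
        exact Z.add_mem (Z.add_mem (Z.sub_mem (Z.sub_mem (Z.sub_mem (Z.sub_mem mG mU) mL) mUW)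
          mWU) mT) mW
      · rw [elDp_eq]; exact Z.sub_mem mU mT
      · rw [elDm_eq]; exact Z.sub_mem mL mT
      · rw [elEp_eq]; exact Z.sub_mem mUW mW
      · rw [elEm_eq]; exact Z.sub_mem mWU mW
    · rintro _ ⟨c, rfl⟩
      simp only [rho, LinearMap.coe_mk, AddHom.coe_mk]
      rw [bpb, pb, bp, ha, hb, hp, hg]
      have kA := Submodule.subset_span (R := ℚ) (s := ({elA ℚ F, elB ℚ F, elC ℚ F, elDp ℚ F, elDm ℚ F, elEp ℚ F, elEm ℚ F} : Set _)) (show elA ℚ F ∈ _ by simp)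
      have kB := Submodule.subset_span (R := ℚ) (s := ({elA ℚ F, elB ℚ F, elC ℚ F, elDp ℚ F, elDm ℚ F, elEp ℚ F, elEm ℚ F} : Set _)) (show elB ℚ F ∈ _ by simp)
      have kC := Submodule.subset_span (R := ℚ) (s := ({elA ℚ F, elB ℚ F, elC ℚ F, elDp ℚ F, elDm ℚ F, elEp ℚ F, elEm ℚ F} : Set _)) (show elC ℚ F ∈ _ by simp)
      have kDp := Submodule.subset_span (R := ℚ) (s := ({elA ℚ F, elB ℚ F, elC ℚ F, elDp ℚ F, elDm ℚ F, elEp ℚ F, elEm ℚ F} : Set _)) (show elDp ℚ F ∈ _ by simp)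
      have kDm := Submodule.subset_span (R := ℚ) (s := ({elA ℚ F, elB ℚ F, elC ℚ F, elDp ℚ F, elDm ℚ F, elEp ℚ F, elEm ℚ F} : Set _)) (show elDm ℚ F ∈ _ by simp)
      have kEp := Submodule.subset_span (R := ℚ) (s := ({elA ℚ F, elB ℚ F, elC ℚ F, elDp ℚ F, elDm ℚ F, elEp ℚ F, elEm ℚ F} : Set _)) (show elEp ℚ F ∈ _ by simp)
      have kEm := Submodule.subset_span (R := ℚ) (s := ({elA ℚ F, elB ℚ F, elC ℚ F, elDp ℚ F, elDm ℚ F, elEp ℚ F, elEm ℚ F} : Set _)) (show elEm ℚ F ∈ _ by simp)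
      generalize Submodule.span ℚ ({elA ℚ F, elB ℚ F, elC ℚ F, elDp ℚ F, elDm ℚ F, elEp ℚ F, elEm ℚ F} : Set _) = Z at *
      rw [SetLike.mem_coe] at kA kB kC kDp kDm kEp kEm
      rw [elA_eq] at kA
      rw [elB_eq] at kB
      rw [elC_eq] at kC
      rw [elDp_eq, Submodule.sub_mem_iff_left _ kA] at kDp
      rw [elDm_eq, Submodule.sub_mem_iff_left _ kA] at kDm
      rw [elEp_eq, Submodule.sub_mem_iff_left _ kB] at kEp
      rw [elEm_eq, Submodule.sub_mem_iff_left _ kB] at kEm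
      rw [Submodule.add_mem_iff_left _ kB, Submodule.add_mem_iff_left _ kA,
        Submodule.sub_mem_iff_left _ kEm, Submodule.sub_mem_iff_left _ kEp,
        Submodule.sub_mem_iff_left _ kDm, Submodule.sub_mem_iff_left _ kDp] at kC
      have sm : ∀ (s t : ℚ) x, x ∈ Z → s • t • x ∈ Z := fun s t x hx =>
        Z.smul_mem s (Z.smul_mem t hx)
      exact Z.add_mem (Z.add_mem (Z.add_mem (Z.add_mem (Z.add_mem (Z.add_mem (sm _ _ _ kA)
        (sm _ _ _ kB)) (sm _ _ _ kDp)) (sm _ _ _ kEp)) (sm _ _ _ kEm)) (sm _ _ _ kDm))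
        (sm _ _ _ kC)
  · have h1 : n / N < 1 := (div_lt_one hN).2 hlt
    have h2 : 0 < n / N := div_pos hn hN
    have : 0 < 1 - (n / N) ^ 2 := by nlinarith
    exact this.ne'
  · refine rho_mul a b p g (n / N) ?_ ?_ ?_ ?_ ?_ ?_ ?_ ?_ bg ?_ ?_ pg ?_ gg pbp0
    · rw [ha, smul_mul_smul_comm, TT, smul_smul]; congr 1; field_simp
    · rw [ha, hb, smul_mul_smul_comm, TW, smul_smul]; congr 1; field_simp
    · rw [ha, hb, smul_mul_smul_comm, WT, smul_smul]; congr 1; field_simp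
    · rw [ha, hp, smul_mul_smul_comm, TU, smul_smul]; congr 1; field_simp
    · rw [ha, hp, smul_mul_smul_comm, UT, smul_smul]; congr 1; field_simp
    · rw [ha, hg, smul_mul_smul_comm, XGT, smul_smul]; congr 1; field_simp
    · rw [ha, hg, smul_mul_smul_comm, GXT, smul_smul]; congr 1; field_simp
    · rw [ha, hb, smul_mul_smul_comm, WW, smul_smul]; congr 1; field_simp
    · rw [hg, hb, smul_mul_smul_comm, GXW, smul_smul]; congr 1; field_simp
    · rw [hp, smul_mul_smul_comm, UU, smul_smul]; congr 1; field_simp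
    · rw [hg, hp, smul_mul_smul_comm, GXU, smul_smul]; congr 1; field_simp
end

section
/- In ℚ[SL₂(F)], each of the elements π₁, π₂, π₃, π₄ commutes with each of the seven support-class elements: πᵢ·X = X·πᵢ for every i ∈ {1,2,3,4} and every X ∈ {A, B, C, D₊, D₋, E₊, E₋} (so π₁, π₂, π₃, π₄ are central in the algebra spanned by the support classes). -/
open MonoidAlgebra

namespace PiCentral

set_option linter.unusedSectionVars false

open Matrix

variable {F : Type*} [Field F] [Fintype F] [DecidableEq F]

local notation "SL" => Matrix.SpecialLinearGroup (Fin 2)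

/-- Sum of the group elements satisfying a predicate. -/
noncomputable def S (p : SL F → Prop) [DecidablePred p] : MonoidAlgebra ℚ (SL F) :=
  ∑ g ∈ Finset.univ.filter p, MonoidAlgebra.of ℚ (SL F) g

theorem S_eq (p : SL F → Prop) [DecidablePred p] :
    S p = ∑ g, (if p g then (1 : ℚ) else 0) • MonoidAlgebra.of ℚ (SL F) g := by
  unfold S
  rw [Finset.sum_filter]
  refine Finset.sum_congr rfl fun g _ => ?_
  split_ifs <;> simp

theorem mul_left (p s r : SL F → Prop) [DecidablePred p] [DecidablePred s] [DecidablePred r]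
    (h : ∀ g, p g → ∀ x, r (g * x) ↔ s x) :
    S p * S s = ((Finset.univ.filter p).card : ℚ) • S r := by
  unfold S
  rw [Finset.sum_mul, Nat.cast_smul_eq_nsmul, ← Finset.sum_const]
  refine Finset.sum_congr rfl fun g hg => ?_
  rw [Finset.mul_sum]
  refine Finset.sum_equiv (Equiv.mulLeft g) (fun x => ?_) (fun x _ => ?_)
  · simp [h g (by simpa using hg)]
  · simp

theorem mul_right (p s r : SL F → Prop) [DecidablePred p] [DecidablePred s] [DecidablePred r]
    (h : ∀ g, s g → ∀ x, r (x * g) ↔ p x) :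
    S p * S s = ((Finset.univ.filter s).card : ℚ) • S r := by
  unfold S
  rw [Finset.sum_mul_sum, Finset.sum_comm, Nat.cast_smul_eq_nsmul, ← Finset.sum_const]
  refine Finset.sum_congr rfl fun g hg => ?_
  refine Finset.sum_equiv (Equiv.mulRight g) (fun x => ?_) (fun x _ => ?_)
  · simp [h g (by simpa using hg)]
  · simp

theorem mul_count (p s r : SL F → Prop) [DecidablePred p] [DecidablePred s] [DecidablePred r]
    (n : ℕ) (h : ∀ x, (Finset.univ.filter fun g => p g ∧ s (g⁻¹ * x)).card = if r x then n else 0) :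
    S p * S s = (n : ℚ) • S r := by
  have h1 : S p * S s = ∑ g ∈ Finset.univ.filter p, ∑ x,
      if s (g⁻¹ * x) then MonoidAlgebra.of ℚ (SL F) x else 0 := by
    unfold S
    rw [Finset.sum_mul]
    refine Finset.sum_congr rfl fun g _ => ?_
    rw [Finset.mul_sum, ← Finset.sum_filter]
    refine Finset.sum_equiv (Equiv.mulLeft g) (fun x => ?_) (fun x _ => ?_)
    · simp
    · simp
  rw [h1, Finset.sum_comm]
  unfold S
  rw [Finset.smul_sum, Finset.sum_filter]
  refine Finset.sum_congr rfl fun x _ => ?_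
  rw [← Finset.sum_filter, Finset.filter_filter, Finset.sum_const, h x]
  split_ifs
  · rw [Nat.cast_smul_eq_nsmul]
  · simp

theorem det_eq (g : SL F) : g 0 0 * g 1 1 - g 0 1 * g 1 0 = 1 := by
  have := g.2
  rwa [Matrix.det_fin_two] at this

abbrev pA (g : SL F) : Prop := g 0 1 = 0 ∧ g 1 0 = 0
abbrev pB (g : SL F) : Prop := g 0 0 = 0 ∧ g 1 1 = 0
abbrev pP (g : SL F) : Prop := g 1 0 = 0
abbrev pM (g : SL F) : Prop := g 0 1 = 0
abbrev pN (g : SL F) : Prop := g 1 1 = 0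
abbrev pQ (g : SL F) : Prop := g 0 0 = 0
abbrev pR (g : SL F) : Prop := g 1 0 ≠ 0
abbrev pG (_ : SL F) : Prop := True

theorem card_units : (Fintype.card Fˣ) = Fintype.card F - 1 := Fintype.card_units F

theorem cardA : (Finset.univ.filter (pA (F := F))).card = Fintype.card F - 1 := by
  rw [← card_units, ← Finset.card_univ]
  symm
  refine Finset.card_bij
    (fun u _ => (⟨!![(u : F), 0; 0, ((u⁻¹ : Fˣ) : F)], by simp [Matrix.det_fin_two]⟩ : SL F)) ?_ ?_ ?_
  · intro u _
    exact Finset.mem_filter.mpr ⟨Finset.mem_univ _, rfl, rfl⟩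
  · intro u _ v _ h
    have := congrArg (fun g : SL F => g 0 0) h
    ext; simpa using this
  · intro g hg
    obtain ⟨h1, h2⟩ : pA g := by simpa using hg
    have hd := det_eq g
    rw [h1, h2] at hd
    have h3 : g 0 0 * g 1 1 = 1 := by linear_combination hd
    refine ⟨⟨g 0 0, g 1 1, h3, by rw [mul_comm]; exact h3⟩, Finset.mem_univ _, ?_⟩
    ext i j
    fin_cases i <;> fin_cases j <;> simp [h1, h2]

theorem cardB : (Finset.univ.filter (pB (F := F))).card = Fintype.card F - 1 := by
  rw [← card_units, ← Finset.card_univ]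
  symm
  refine Finset.card_bij
    (fun u _ => (⟨!![0, (u : F); -((u⁻¹ : Fˣ) : F), 0], by simp [Matrix.det_fin_two]⟩ : SL F)) ?_ ?_ ?_
  · intro u _
    exact Finset.mem_filter.mpr ⟨Finset.mem_univ _, rfl, rfl⟩
  · intro u _ v _ h
    have := congrArg (fun g : SL F => g 0 1) h
    ext; simpa using this
  · intro g hg
    obtain ⟨h1, h2⟩ : pB g := by simpa using hg
    have hd := det_eq g
    rw [h1, h2] at hd
    have h3 : g 0 1 * -g 1 0 = 1 := by linear_combination hd
    refine ⟨⟨g 0 1, -g 1 0, h3, by rw [mul_comm]; exact h3⟩, Finset.mem_univ _, ?_⟩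
    ext i j
    fin_cases i <;> fin_cases j <;> simp [h1, h2]

theorem cardP : (Finset.univ.filter (pP (F := F))).card
    = (Fintype.card F - 1) * Fintype.card F := by
  rw [← card_units, ← Fintype.card_prod, ← Finset.card_univ]
  symm
  refine Finset.card_bij
    (fun u _ => (⟨!![(u.1 : F), u.2; 0, ((u.1⁻¹ : Fˣ) : F)], by simp [Matrix.det_fin_two]⟩ : SL F))
    ?_ ?_ ?_
  · intro u _
    exact Finset.mem_filter.mpr ⟨Finset.mem_univ _, rfl⟩
  · intro u _ v _ h
    have h0 := congrArg (fun g : SL F => g 0 0) h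
    have h1 := congrArg (fun g : SL F => g 0 1) h
    ext
    · simpa using h0
    · simpa using h1
  · intro g hg
    have h2 : pP g := by simpa using hg
    have hd := det_eq g
    rw [h2] at hd
    have h3 : g 0 0 * g 1 1 = 1 := by linear_combination hd
    refine ⟨(⟨g 0 0, g 1 1, h3, by rw [mul_comm]; exact h3⟩, g 0 1), Finset.mem_univ _, ?_⟩
    ext i j
    fin_cases i <;> fin_cases j <;> simp [h2]

theorem mul00 (g h : SL F) : (g * h) 0 0 = g 0 0 * h 0 0 + g 0 1 * h 1 0 :=
  (congrFun₂ (Matrix.SpecialLinearGroup.coe_mul g h) 0 0).trans (by rw [Matrix.mul_apply, Fin.sum_univ_two])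
theorem mul01 (g h : SL F) : (g * h) 0 1 = g 0 0 * h 0 1 + g 0 1 * h 1 1 :=
  (congrFun₂ (Matrix.SpecialLinearGroup.coe_mul g h) 0 1).trans (by rw [Matrix.mul_apply, Fin.sum_univ_two])
theorem mul10 (g h : SL F) : (g * h) 1 0 = g 1 0 * h 0 0 + g 1 1 * h 1 0 :=
  (congrFun₂ (Matrix.SpecialLinearGroup.coe_mul g h) 1 0).trans (by rw [Matrix.mul_apply, Fin.sum_univ_two])
theorem mul11 (g h : SL F) : (g * h) 1 1 = g 1 0 * h 0 1 + g 1 1 * h 1 1 :=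
  (congrFun₂ (Matrix.SpecialLinearGroup.coe_mul g h) 1 1).trans (by rw [Matrix.mul_apply, Fin.sum_univ_two])
theorem inv00 (g : SL F) : g⁻¹ 0 0 = g 1 1 :=
  (congrFun₂ (Matrix.SpecialLinearGroup.coe_inv g) 0 0).trans (by rw [Matrix.adjugate_fin_two]; rfl)
theorem inv01 (g : SL F) : g⁻¹ 0 1 = -g 0 1 :=
  (congrFun₂ (Matrix.SpecialLinearGroup.coe_inv g) 0 1).trans (by rw [Matrix.adjugate_fin_two]; rfl)

theorem countPQ (x : SL F) : (Finset.univ.filter fun g => pP g ∧ pQ (g⁻¹ * x)).card =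
    if pR x then Fintype.card F - 1 else 0 := by
  have key : ∀ g : SL F, (g⁻¹ * x) 0 0 = g 1 1 * x 0 0 - g 0 1 * x 1 0 := by
    intro g
    rw [mul00, inv00, inv01]
    ring
  split_ifs with hx
  · rw [← card_units, ← Finset.card_univ]
    symm
    refine Finset.card_bij
      (fun u _ => (⟨!![(u : F), ((u⁻¹ : Fˣ) : F) * x 0 0 / x 1 0; 0, ((u⁻¹ : Fˣ) : F)],
        by simp [Matrix.det_fin_two]⟩ : SL F)) ?_ ?_ ?_
    · intro u _
      refine Finset.mem_filter.mpr ⟨Finset.mem_univ _, rfl, ?_⟩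
      unfold pQ
      refine (key _).trans ?_
      have hx' : x 1 0 ≠ 0 := hx
      change ((u⁻¹ : Fˣ) : F) * x 0 0 - ((u⁻¹ : Fˣ) : F) * x 0 0 / x 1 0 * x 1 0 = 0
      rw [div_mul_cancel₀ _ hx', sub_self]
    · intro u _ v _ h
      have := congrArg (fun g : SL F => g 0 0) h
      ext; simpa using this
    · intro g hg
      rw [Finset.mem_filter] at hg
      obtain ⟨-, h2, h4⟩ := hg
      unfold pQ at h4
      rw [key] at h4
      have hd := det_eq g
      rw [h2] at hd
      have h3 : g 0 0 * g 1 1 = 1 := by linear_combination hd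
      have hx' : x 1 0 ≠ 0 := hx
      have h5 : g 1 1 * x 0 0 / x 1 0 = g 0 1 := by
        rw [div_eq_iff hx']; linear_combination h4
      refine ⟨⟨g 0 0, g 1 1, h3, by rw [mul_comm]; exact h3⟩, Finset.mem_univ _, ?_⟩
      ext i j
      fin_cases i <;> fin_cases j <;> simp [h2, h5]
  · rw [Finset.card_eq_zero, Finset.filter_eq_empty_iff]
    rintro g - ⟨h2, h4⟩
    unfold pQ at h4
    rw [key] at h4
    have hx' : x 1 0 = 0 := by simpa using hx
    have hd := det_eq g
    have hdx := det_eq x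
    unfold pP at h2
    rw [h2] at hd
    rw [hx'] at h4 hdx
    have : (1 : F) = 0 := by
      linear_combination -hd - (g 0 0 * g 1 1) * hdx + g 0 0 * x 1 1 * h4
    exact one_ne_zero this

theorem neA {g : SL F} (h : pA g) : g 0 0 ≠ 0 ∧ g 1 1 ≠ 0 := by
  have hd := det_eq g
  constructor <;> intro h' <;> rw [h', h.1] at hd <;> simp at hd
theorem neB {g : SL F} (h : pB g) : g 0 1 ≠ 0 ∧ g 1 0 ≠ 0 := by
  have hd := det_eq g
  constructor <;> intro h' <;> rw [h', h.1] at hd <;> simp at hd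
theorem neP {g : SL F} (h : pP g) : g 0 0 ≠ 0 ∧ g 1 1 ≠ 0 := by
  have hd := det_eq g
  unfold pP at h
  constructor <;> intro h' <;> rw [h', h] at hd <;> simp at hd

/-- `q - 1` as a rational number. -/
noncomputable def k (F : Type*) [Fintype F] : ℚ := ((Fintype.card F - 1 : ℕ) : ℚ)

theorem lA (s : SL F → Prop) [DecidablePred s] (h : ∀ g, pA g → ∀ x, s (g * x) ↔ s x) :
    S pA * S s = k F • S s := by
  rw [mul_left pA s s h, cardA, k]
theorem rA (s : SL F → Prop) [DecidablePred s] (h : ∀ g, pA g → ∀ x, s (x * g) ↔ s x) :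
    S s * S pA = k F • S s := by
  rw [mul_right s pA s h, cardA, k]
theorem lB (s r : SL F → Prop) [DecidablePred s] [DecidablePred r]
    (h : ∀ g, pB g → ∀ x, r (g * x) ↔ s x) : S pB * S s = k F • S r := by
  rw [mul_left pB s r h, cardB, k]
theorem rB (s r : SL F → Prop) [DecidablePred s] [DecidablePred r]
    (h : ∀ g, pB g → ∀ x, r (x * g) ↔ s x) : S s * S pB = k F • S r := by
  rw [mul_right s pB r h, cardB, k]

theorem AP : S pA * S (pP (F := F)) = k F • S pP := lA _ fun g hg x => by
  simp [pP, mul10, hg.2, (neA hg).2]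
theorem PA : S (pP (F := F)) * S pA = k F • S pP := rA _ fun g hg x => by
  simp [pP, mul10, hg.2, (neA hg).1]
theorem AB : S pA * S (pB (F := F)) = k F • S pB := lA _ fun g hg x => by
  simp [pB, mul00, mul11, hg.1, hg.2, (neA hg).1, (neA hg).2]
theorem BA : S (pB (F := F)) * S pA = k F • S pB := rA _ fun g hg x => by
  simp [pB, mul00, mul11, hg.1, hg.2, (neA hg).1, (neA hg).2]
theorem BP : S pB * S (pP (F := F)) = k F • S pQ := lB _ _ fun g hg x => by
  simp [pQ, mul00, hg.1, (neB hg).1]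
theorem BQ : S pB * S (pQ (F := F)) = k F • S pP := lB _ _ fun g hg x => by
  simp [pP, pQ, mul10, hg.2, (neB hg).2]
theorem BM : S pB * S (pM (F := F)) = k F • S pN := lB _ _ fun g hg x => by
  simp [pM, pN, mul11, hg.2, (neB hg).2]
theorem BN : S pB * S (pN (F := F)) = k F • S pM := lB _ _ fun g hg x => by
  simp [pM, pN, mul01, hg.1, (neB hg).1]
theorem PB : S (pP (F := F)) * S pB = k F • S pN := rB _ _ fun g hg x => by
  simp [pN, mul11, hg.2, (neB hg).1]
theorem NB : S (pN (F := F)) * S pB = k F • S pP := rB _ _ fun g hg x => by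
  simp [pP, pN, mul10, hg.1, (neB hg).2]
theorem MB : S (pM (F := F)) * S pB = k F • S pQ := rB _ _ fun g hg x => by
  simp [pQ, mul00, hg.1, (neB hg).2]
theorem QB : S (pQ (F := F)) * S pB = k F • S pM := rB _ _ fun g hg x => by
  simp [pM, mul01, hg.2, (neB hg).1]
theorem PP : S (pP (F := F)) * S pP = (k F * Fintype.card F) • S pP := by
  rw [mul_left pP pP pP, cardP, Nat.cast_mul, k]
  intro g hg x
  simp [pP, mul10, (neP hg).2, show g 1 0 = 0 from hg]
theorem PR : S (pP (F := F)) + S pR = S pG := by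
  unfold S
  rw [Finset.sum_filter_add_sum_filter_not]
  simp
theorem PQ : S (pP (F := F)) * S pQ = k F • (S pG - S pP) := by
  rw [← PR, add_sub_cancel_left, mul_count pP pQ pR _ countPQ, k]
theorem commG (s : SL F → Prop) [DecidablePred s] : S s * S pG = S pG * S s := by
  rw [mul_left s pG pG (by simp), mul_right pG s pG (by simp)]

theorem eA : elA ℚ F = S pA := by
  unfold elA suppClass S
  refine Finset.sum_congr (Finset.filter_congr fun g _ => ?_) fun _ _ => rfl
  have := neA (g := g)
  unfold pA at *
  simp; tauto
theorem eB : elB ℚ F = S pB := by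
  unfold elB suppClass S
  refine Finset.sum_congr (Finset.filter_congr fun g _ => ?_) fun _ _ => rfl
  have := neB (g := g)
  unfold pB at *
  simp; tauto

theorem sum_split (p s r : SL F → Prop) [DecidablePred p] [DecidablePred s] [DecidablePred r]
    (h1 : ∀ g, ¬ (p g ∧ s g)) (h2 : ∀ g, r g ↔ p g ∨ s g) : S s = S r - S p := by
  rw [eq_sub_iff_add_eq, S_eq, S_eq, S_eq, ← Finset.sum_add_distrib]
  refine Finset.sum_congr rfl fun g _ => ?_
  have := h1 g
  rw [← add_smul]
  simp only [h2 g]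
  by_cases hp : p g <;> by_cases hs : s g <;> simp_all

theorem eDp : elDp ℚ F = S pP - S pA := by
  refine sum_split pA _ pP (fun g => ?_) (fun g => ?_)
  · unfold pA; simp; tauto
  · have := neP (g := g)
    unfold pP pA at *
    simp; tauto
theorem neM {g : SL F} (h : pM g) : g 0 0 ≠ 0 ∧ g 1 1 ≠ 0 := by
  have hd := det_eq g
  unfold pM at h
  constructor <;> intro h' <;> rw [h', h] at hd <;> simp at hd
theorem neN {g : SL F} (h : pN g) : g 0 1 ≠ 0 ∧ g 1 0 ≠ 0 := by
  have hd := det_eq g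
  unfold pN at h
  constructor <;> intro h' <;> rw [h', h] at hd <;> simp at hd
theorem neQ {g : SL F} (h : pQ g) : g 0 1 ≠ 0 ∧ g 1 0 ≠ 0 := by
  have hd := det_eq g
  unfold pQ at h
  constructor <;> intro h' <;> rw [h', h] at hd <;> simp at hd
theorem eDm : elDm ℚ F = S pM - S pA := by
  refine sum_split pA _ pM (fun g => ?_) (fun g => ?_)
  · unfold pA; simp; tauto
  · have := neM (g := g)
    unfold pM pA at *
    simp; tauto
theorem eEp : elEp ℚ F = S pN - S pB := by
  refine sum_split pB _ pN (fun g => ?_) (fun g => ?_)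
  · unfold pB; simp; tauto
  · have := neN (g := g)
    unfold pN pB at *
    simp; tauto
theorem eEm : elEm ℚ F = S pQ - S pB := by
  refine sum_split pB _ pQ (fun g => ?_) (fun g => ?_)
  · unfold pB; simp; tauto
  · have := neQ (g := g)
    unfold pQ pB at *
    simp; tauto
theorem eC : elC ℚ F = S pG + S pA + S pB - S pP - S pM - S pN - S pQ := by
  have h : elC ℚ F = S (fun g : SL F => g 0 0 ≠ 0 ∧ g 0 1 ≠ 0 ∧ g 1 0 ≠ 0 ∧ g 1 1 ≠ 0) := by
    unfold elC suppClass S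
    refine Finset.sum_congr (Finset.filter_congr fun g _ => ?_) fun _ _ => rfl
    simp
  rw [h]
  simp only [S_eq, ← Finset.sum_add_distrib, ← Finset.sum_sub_distrib, ← add_smul, ← sub_smul]
  refine Finset.sum_congr rfl fun g _ => ?_
  congr 1
  have hP := neP (g := g)
  have hM := neM (g := g)
  have hN := neN (g := g)
  have hQ := neQ (g := g)
  unfold pP at *
  unfold pM pN pQ pA pB pG at *
  by_cases h1 : g 0 0 = 0 <;> by_cases h2 : g 0 1 = 0 <;> by_cases h3 : g 1 0 = 0 <;>
    by_cases h4 : g 1 1 = 0 <;> simp_all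

/-- The abstract computation. -/
theorem abstract_comm {R : Type*} [Ring R] [Algebra ℚ R] (A B P M N Q G : R) (k q : ℚ)
    (hk : k ≠ 0) (AB : A * B = k • B) (BA : B * A = k • B)
    (AP : A * P = k • P) (PA : P * A = k • P) (BP : B * P = k • Q) (BQ : B * Q = k • P)
    (BM : B * M = k • N) (BN : B * N = k • M) (PB : P * B = k • N) (NB : N * B = k • P)
    (MB : M * B = k • Q) (QB : Q * B = k • M) (PP : P * P = (k * q) • P)
    (PQ : P * Q = k • (G - P)) (GA : A * G = G * A) (GB : B * G = G * B) (GP : P * G = G * P)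
    (BG : B * G = k • G)
    (a b c d e : ℚ) (h : b + 2 * c - d - 2 * e + q * (e - c) = 0) (Z : R)
    (hZ : Z = a • A + b • B + c • (G + A + B - P - M - N - Q) + d • (P + M - (2 : ℚ) • A)
      + e • (N + Q - (2 : ℚ) • B)) :
    Commute Z A ∧ Commute Z B ∧ Commute Z P ∧ Commute Z M ∧ Commute Z N ∧ Commute Z Q ∧
      Commute Z G := by
  have hN : N = k⁻¹ • (P * B) := by rw [PB, smul_smul, inv_mul_cancel₀ hk, one_smul]
  have hQ : Q = k⁻¹ • (B * P) := by rw [BP, smul_smul, inv_mul_cancel₀ hk, one_smul]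
  have hM : M = k⁻¹ • (B * N) := by rw [BN, smul_smul, inv_mul_cancel₀ hk, one_smul]
  have hM' : M = k⁻¹ • (Q * B) := by rw [QB, smul_smul, inv_mul_cancel₀ hk, one_smul]
  have cGA : Commute G A := GA.symm
  have cGB : Commute G B := GB.symm
  have cGP : Commute G P := GP.symm
  have cGN : Commute G N := by rw [hN]; exact (cGP.mul_right cGB).smul_right _
  have cGQ : Commute G Q := by rw [hQ]; exact (cGB.mul_right cGP).smul_right _
  have cGM : Commute G M := by rw [hM]; exact (cGB.mul_right cGN).smul_right _
  have cAB : Commute A B := AB.trans BA.symm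
  have cAP : Commute A P := AP.trans PA.symm
  have cAN : Commute A N := by rw [hN]; exact (cAP.mul_right cAB).smul_right _
  have cAQ : Commute A Q := by rw [hQ]; exact (cAB.mul_right cAP).smul_right _
  have cAM : Commute A M := by rw [hM]; exact (cAB.mul_right cAN).smul_right _
  have GB' : G * B = k • G := by rw [← GB, BG]
  have PN : P * N = (k * q) • N := by
    rw [hN, mul_smul_comm, ← mul_assoc, PP, smul_mul_assoc, smul_comm]
  have QP : Q * P = (k * q) • Q := by
    rw [hQ, smul_mul_assoc, mul_assoc, PP, mul_smul_comm, smul_comm]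
  have NP : N * P = k • (G - P) := by
    rw [← PQ, hN, hQ, smul_mul_assoc, mul_smul_comm, mul_assoc]
  have PM : P * M = k • (G - N) := by
    rw [hM', mul_smul_comm, ← mul_assoc, PQ, smul_mul_assoc, sub_mul, GB', PB, ← smul_sub,
      smul_smul, inv_mul_cancel₀ hk, one_smul]
  have MP : M * P = k • (G - Q) := by
    rw [hM, smul_mul_assoc, mul_assoc, NP, mul_smul_comm, mul_sub, BG, BP, ← smul_sub,
      smul_smul, inv_mul_cancel₀ hk, one_smul]
  have zA : Commute Z A := by
    apply Commute.symm
    rw [hZ]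
    have r := Commute.refl A
    have h1 : Commute A (G + A + B - P - M - N - Q) :=
      ((((((cGA.symm.add_right r).add_right cAB).sub_right cAP).sub_right cAM).sub_right
        cAN).sub_right cAQ)
    exact (((((r.smul_right a).add_right (cAB.smul_right b)).add_right (h1.smul_right c)).add_right
      (((cAP.add_right cAM).sub_right (r.smul_right _)).smul_right d)).add_right
      (((cAN.add_right cAQ).sub_right (cAB.smul_right _)).smul_right e))
  have zG : Commute Z G := by
    apply Commute.symm
    rw [hZ]
    have r := Commute.refl G
    have h1 : Commute G (G + A + B - P - M - N - Q) :=
      ((((((r.add_right cGA).add_right cGB).sub_right cGP).sub_right cGM).sub_right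
        cGN).sub_right cGQ)
    exact ((((cGA.smul_right a).add_right (cGB.smul_right b)).add_right (h1.smul_right c)).add_right
      (((cGP.add_right cGM).sub_right (cGA.smul_right _)).smul_right d)).add_right
      (((cGN.add_right cGQ).sub_right (cGB.smul_right _)).smul_right e)
  have zB : Commute Z B := by
    unfold Commute SemiconjBy
    rw [hZ]
    simp only [add_mul, sub_mul, mul_add, mul_sub, smul_mul_assoc, mul_smul_comm,
      AB, BA, BP, BQ, BM, BN, PB, NB, MB, QB, BG, GB']
    module
  have zP : Commute Z P := by
    unfold Commute SemiconjBy
    rw [hZ]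
    simp only [add_mul, sub_mul, mul_add, mul_sub, smul_mul_assoc, mul_smul_comm,
      AP, PA, BP, PB, PP, PQ, QP, PN, NP, PM, MP, GP]
    have hb : b = -2 * c + d + 2 * e - q * (e - c) := by linear_combination h
    subst hb
    module
  have zN : Commute Z N := by rw [hN]; exact (zP.mul_right zB).smul_right _
  have zQ : Commute Z Q := by rw [hQ]; exact (zB.mul_right zP).smul_right _
  have zM : Commute Z M := by rw [hM]; exact (zB.mul_right zN).smul_right _
  exact ⟨zA, zB, zP, zM, zN, zQ, zG⟩

theorem central (hq : 2 < Fintype.card F) (a b c d e : ℚ)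
    (h : b + 2 * c - d - 2 * e + (Fintype.card F : ℚ) * (e - c) = 0)
    (Z : MonoidAlgebra ℚ (SL F))
    (hZ : Z = a • elA ℚ F + b • elB ℚ F + c • elC ℚ F + d • (elDp ℚ F + elDm ℚ F)
      + e • (elEp ℚ F + elEm ℚ F)) :
    ∀ X ∈ ({elA ℚ F, elB ℚ F, elC ℚ F, elDp ℚ F, elDm ℚ F, elEp ℚ F, elEm ℚ F} :
      Set (MonoidAlgebra ℚ (SL F))), Z * X = X * Z := by
  have hk : k F ≠ 0 := by
    unfold k
    have : Fintype.card F - 1 ≠ 0 := by omega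
    exact_mod_cast this
  have BG : S (pB (F := F)) * S pG = k F • S pG := lB _ _ fun g hg x => Iff.rfl
  obtain ⟨zA, zB, zP, zM, zN, zQ, zG⟩ := abstract_comm (S (pA (F := F))) (S pB) (S pP) (S pM)
    (S pN) (S pQ) (S pG) (k F) (Fintype.card F) hk AB BA AP PA BP BQ BM BN PB NB MB QB PP PQ
    (commG _) (commG _) (commG _) BG a b c d e h Z (by
      rw [hZ, eA, eB, eC, eDp, eDm, eEp, eEm]
      module)
  intro X hX
  simp only [Set.mem_insert_iff, Set.mem_singleton_iff] at hX
  change Commute Z X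
  rcases hX with rfl | rfl | rfl | rfl | rfl | rfl | rfl
  · rw [eA]; exact zA
  · rw [eB]; exact zB
  · rw [eC]
    exact ((((((zG.add_right zA).add_right zB).sub_right zP).sub_right zM).sub_right
        zN).sub_right zQ)
  · rw [eDp]; exact zP.sub_right zA
  · rw [eDm]; exact zM.sub_right zA
  · rw [eEp]; exact zN.sub_right zB
  · rw [eEm]; exact zQ.sub_right zB

end PiCentral

theorem pi_central (F : Type*) [Field F] [Fintype F] [DecidableEq F]
    (hq : 2 < Fintype.card F) (q : ℚ) (hqc : q = Fintype.card F)
    (π₁ π₂ π₃ π₄ : MonoidAlgebra ℚ (Matrix.SpecialLinearGroup (Fin 2) F))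
    (hπ₁ : π₁ = (q ^ 3 - q)⁻¹ •
      (elA ℚ F + elB ℚ F + elC ℚ F + elDp ℚ F + elDm ℚ F + elEp ℚ F + elEm ℚ F))
    (hπ₂ : π₂ = ((q - 2) / (2 * (q ^ 2 - q))) • (elA ℚ F + elB ℚ F) +
      (q * (q - 1) ^ 2)⁻¹ • elC ℚ F -
      ((q - 2) / (2 * q * (q - 1) ^ 2)) • (elDp ℚ F + elDm ℚ F + elEp ℚ F + elEm ℚ F))
    (hπ₃ : π₃ = (2 * (q + 1))⁻¹ • (elA ℚ F - elB ℚ F) +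
      (2 * (q ^ 2 - 1))⁻¹ • (-elDp ℚ F - elDm ℚ F + elEp ℚ F + elEm ℚ F))
    (hπ₄ : π₄ = ((q + 1) * (q - 1) ^ 2)⁻¹ •
      ((2 * (q - 1)) • elA ℚ F - (2 : ℚ) • elC ℚ F + (q - 2) • (elDp ℚ F + elDm ℚ F) -
        (elEp ℚ F + elEm ℚ F))) :
    ∀ π ∈ ({π₁, π₂, π₃, π₄} : Set (MonoidAlgebra ℚ (Matrix.SpecialLinearGroup (Fin 2) F))),
      ∀ X ∈ ({elA ℚ F, elB ℚ F, elC ℚ F, elDp ℚ F, elDm ℚ F, elEp ℚ F, elEm ℚ F} : Set (MonoidAlgebra ℚ (Matrix.SpecialLinearGroup (Fin 2) F))),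
        π * X = X * π := by
  have hq2 : (2 : ℚ) < q := by rw [hqc]; exact_mod_cast hq
  have h0 : q ≠ 0 := by linarith
  have h1 : q - 1 ≠ 0 := by intro h; linarith
  have h2 : q + 1 ≠ 0 := by intro h; linarith
  have h3 : q ^ 2 - q ≠ 0 := by
    rw [show q ^ 2 - q = q * (q - 1) by ring]; exact mul_ne_zero h0 h1
  have h4 : q ^ 2 - 1 ≠ 0 := by
    rw [show q ^ 2 - 1 = (q + 1) * (q - 1) by ring]; exact mul_ne_zero h2 h1
  intro π hπ
  simp only [Set.mem_insert_iff, Set.mem_singleton_iff] at hπ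
  rcases hπ with rfl | rfl | rfl | rfl
  · refine PiCentral.central hq (q ^ 3 - q)⁻¹ (q ^ 3 - q)⁻¹ (q ^ 3 - q)⁻¹ (q ^ 3 - q)⁻¹
      (q ^ 3 - q)⁻¹ ?_ _ ?_
    · ring
    · rw [hπ₁]; module
  · refine PiCentral.central hq ((q - 2) / (2 * (q ^ 2 - q))) ((q - 2) / (2 * (q ^ 2 - q)))
      (q * (q - 1) ^ 2)⁻¹ (-((q - 2) / (2 * q * (q - 1) ^ 2)))
      (-((q - 2) / (2 * q * (q - 1) ^ 2))) ?_ _ ?_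
    · rw [← hqc, show q ^ 2 - q = q * (q - 1) by ring]
      field_simp
      ring
    · rw [hπ₂]; module
  · refine PiCentral.central hq (2 * (q + 1))⁻¹ (-(2 * (q + 1))⁻¹) 0 (-(2 * (q ^ 2 - 1))⁻¹)
      (2 * (q ^ 2 - 1))⁻¹ ?_ _ ?_
    · rw [← hqc, show q ^ 2 - 1 = (q + 1) * (q - 1) by ring]
      field_simp
      ring
    · rw [hπ₃]; module
  · refine PiCentral.central hq (((q + 1) * (q - 1) ^ 2)⁻¹ * (2 * (q - 1))) 0
      (-(((q + 1) * (q - 1) ^ 2)⁻¹ * 2)) (((q + 1) * (q - 1) ^ 2)⁻¹ * (q - 2))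
      (-((q + 1) * (q - 1) ^ 2)⁻¹) ?_ _ ?_
    · rw [← hqc]
      ring
    · rw [hπ₄]; module
end

section
/- Let K be a field in which 2·(q²−1) is nonzero (i.e. the characteristic of K does not divide 2(q²−1)). Define in K[SL₂(F)] the elements M₁₁, M₁₂, M₂₁, M₂₂ by the formulas below (all denominators are invertible in K). Then the K-linear map φ : Matrix (Fin 2) (Fin 2) K → K[SL₂(F)] sending the matrix (a b; c d) to a·M₁₁ + b·M₁₂ + c·M₂₁ + d·M₂₂ is injective and multiplicative: φ(x·y) = φ(x)·φ(y) for all 2×2 matrices x, y over K. In particular φ restricts to an injective multiplication-preserving (non-unital) embedding of the group SL₂(K) into the group algebra K[SL₂(F)]. -/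
open MonoidAlgebra

abbrev SLF (F : Type*) [Field F] := Matrix.SpecialLinearGroup (Fin 2) F

/-- The group algebra element with prescribed coefficients. -/
noncomputable def ofFun (K F : Type*) [Field K] [Field F] [Fintype F] [DecidableEq F]
    (p : SLF F → K) : MonoidAlgebra K (SLF F) :=
  ∑ g : SLF F, MonoidAlgebra.single g (p g)

section helpers
variable {K F : Type*} [Field K] [Field F] [Fintype F] [DecidableEq F]

lemma ofFun_add (p r : SLF F → K) : ofFun K F (p + r) = ofFun K F p + ofFun K F r := by
  simp [ofFun, Finset.sum_add_distrib]

lemma ofFun_smul (c : K) (p : SLF F → K) : ofFun K F (c • p) = c • ofFun K F p := by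
  simp [ofFun, Finset.smul_sum]

lemma ofFun_sub (p r : SLF F → K) : ofFun K F (p - r) = ofFun K F p - ofFun K F r := by
  have h : p - r = p + (-1 : K) • r := by ext; simp [sub_eq_add_neg]
  rw [h, ofFun_add, ofFun_smul]; simp [sub_eq_add_neg]

lemma ofFun_sum {ι : Type*} (s : Finset ι) (p : ι → SLF F → K) :
    ∑ i ∈ s, ofFun K F (p i) = ofFun K F (fun g => ∑ i ∈ s, p i g) := by
  classical
  induction s using Finset.induction_on with
  | empty => simp [ofFun]
  | insert a s ha ih =>
    rw [Finset.sum_insert ha, ih, ← ofFun_add]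
    congr 1; ext g; simp [Finset.sum_insert ha]

lemma single_mul_ofFun (h : SLF F) (p : SLF F → K) :
    MonoidAlgebra.single h (1 : K) * ofFun K F p = ofFun K F (fun u => p (h⁻¹ * u)) := by
  unfold ofFun
  rw [Finset.mul_sum]
  refine Fintype.sum_equiv (Equiv.mulLeft h) _ _ ?_
  intro x; simp [MonoidAlgebra.single_mul_single]

lemma ofFun_mul_single (h : SLF F) (p : SLF F → K) :
    ofFun K F p * MonoidAlgebra.single h (1 : K) = ofFun K F (fun u => p (u * h⁻¹)) := by
  unfold ofFun
  rw [Finset.sum_mul]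
  refine Fintype.sum_equiv (Equiv.mulRight h) _ _ ?_
  intro x; simp [MonoidAlgebra.single_mul_single]

lemma ofFun_inj {p r : SLF F → K} (h : ofFun K F p = ofFun K F r) (g : SLF F) : p g = r g := by
  classical
  have h2 := congrArg (fun f : MonoidAlgebra K (SLF F) => f.coeff g) h
  simpa [ofFun, Finsupp.single_apply] using h2

/-- The sum of all `g` with `g i j = 0`. -/
noncomputable def YY (K F : Type*) [Field K] [Field F] [Fintype F] [DecidableEq F]
    (i j : Fin 2) : MonoidAlgebra K (SLF F) :=
  ofFun K F (fun g => if g.1 i j = 0 then 1 else 0)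

noncomputable def JJ (K F : Type*) [Field K] [Field F] [Fintype F] [DecidableEq F] :
    MonoidAlgebra K (SLF F) := ofFun K F (fun _ => 1)

def wE (F : Type*) [Field F] : SLF F := ⟨!![0, -1; 1, 0], by simp [Matrix.det_fin_two]⟩

def bE (F : Type*) [Field F] (p : Fˣ × F) : SLF F :=
  ⟨!![(p.1 : F), p.2; 0, (p.1⁻¹ : Fˣ)], by simp [Matrix.det_fin_two]⟩

lemma wE_inv : (wE F).1.adjugate = !![0, 1; -1, 0] := by
  simp only [wE, Matrix.adjugate_fin_two_of]
  simp

lemma bE_inv (p : Fˣ × F) : (bE F p).1.adjugate = !![(p.1 : F)⁻¹, -p.2; 0, (p.1 : F)] := by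
  simp only [bE, Matrix.adjugate_fin_two_of]
  simp

lemma S_eq : YY K F 1 0 = ∑ p : Fˣ × F, MonoidAlgebra.single (bE F p) (1 : K) := by
  unfold YY ofFun
  have : ∀ g : SLF F, MonoidAlgebra.single g (if g.1 1 0 = 0 then (1:K) else 0)
      = if g.1 1 0 = 0 then MonoidAlgebra.single g (1:K) else 0 := by
    intro g; split_ifs <;> simp
  simp only [this]
  rw [← Finset.sum_filter]
  symm
  refine Finset.sum_bij (fun p _ => bE F p) ?_ ?_ ?_ ?_
  · intro p _; rw [Finset.mem_filter]; exact ⟨Finset.mem_univ _, by simp [bE]⟩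
  · rintro ⟨a, x⟩ _ ⟨b, y⟩ _ h
    have h1 := congrArg (fun g : SLF F => g.1 0 0) h
    have h2 := congrArg (fun g : SLF F => g.1 0 1) h
    simp [bE] at h1 h2
    rw [Units.ext h1, h2]
  · intro g hg
    have hg : g.1 1 0 = 0 := by simpa using hg
    have hd := g.2
    rw [Matrix.det_fin_two, hg, mul_zero, sub_zero] at hd
    refine ⟨(Units.mkOfMulEqOne _ _ hd, g.1 0 1), Finset.mem_univ _, ?_⟩
    apply Subtype.ext
    ext i j
    fin_cases i <;> fin_cases j <;> simp [bE, hg, Units.mkOfMulEqOne]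
  · intros; rfl

lemma w_mul (k l : Fin 2) : MonoidAlgebra.single (wE F) (1 : K) * YY K F k l = YY K F (k+1) l := by
  unfold YY
  rw [single_mul_ofFun]
  congr 1; ext g
  fin_cases k <;>
    simp [wE_inv, Matrix.mul_apply, Fin.sum_univ_two]

lemma mul_w (k l : Fin 2) : YY K F k l * MonoidAlgebra.single (wE F) (1 : K) = YY K F k (l+1) := by
  unfold YY
  rw [ofFun_mul_single]
  congr 1; ext g
  fin_cases l <;>
    simp [wE_inv, Matrix.mul_apply, Fin.sum_univ_two]

lemma w_J : MonoidAlgebra.single (wE F) (1 : K) * JJ K F = JJ K F := by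
  unfold JJ
  rw [single_mul_ofFun]

lemma w_mul_sub (l : Fin 2) : MonoidAlgebra.single (wE F) (1 : K) * (JJ K F - YY K F 1 l) =
    JJ K F - YY K F (1 + 1) l := by
  rw [mul_sub, w_J, w_mul]

lemma card_units_cast : (Fintype.card Fˣ : K) = (Fintype.card F : K) - 1 := by
  rw [Fintype.card_units, Nat.cast_sub Fintype.card_pos]; simp

lemma S_J (q : K) (hq : q = Fintype.card F) : YY K F 1 0 * JJ K F = (q * (q - 1)) • JJ K F := by
  rw [S_eq, Finset.sum_mul]
  simp only [JJ, single_mul_ofFun]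
  simp [card_units_cast, ← hq, ← Nat.cast_smul_eq_nsmul K, mul_comm]

lemma S_Y1 (q : K) (hq : q = Fintype.card F) (l : Fin 2) :
    YY K F 1 0 * YY K F 1 l = (q * (q - 1)) • YY K F 1 l := by
  rw [S_eq, Finset.sum_mul]
  simp only [YY, single_mul_ofFun, ofFun_sum, ← ofFun_smul]
  congr 1; ext u
  simp [bE_inv, Matrix.mul_apply, Fin.sum_univ_two, card_units_cast, ← hq]
  rw [mul_comm]

lemma S_Y0 (q : K) (hq : q = Fintype.card F) (l : Fin 2) :
    YY K F 1 0 * YY K F 0 l = (q - 1) • (JJ K F - YY K F 1 l) := by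
  rw [S_eq, Finset.sum_mul]
  simp only [YY, JJ, single_mul_ofFun, ofFun_sum, ← ofFun_smul, ← ofFun_sub]
  congr 1; ext u
  rw [Fintype.sum_prod_type]
  have key : ∀ a : Fˣ, ∑ x : F, (if ((bE F (a, x))⁻¹ * u).1 0 l = 0 then (1:K) else 0)
      = if u.1 1 l = 0 then 0 else 1 := by
    intro a
    have e : ∀ x : F, ((bE F (a, x))⁻¹ * u).1 0 l = (a:F)⁻¹ * u.1 0 l - x * u.1 1 l := by
      intro x
      simp [bE_inv, Matrix.mul_apply, Fin.sum_univ_two, sub_eq_add_neg]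
    simp only [e]
    split_ifs with h
    · have h0 : u.1 0 l ≠ 0 := by
        intro h0
        have hd := u.2
        rw [Matrix.det_fin_two] at hd
        fin_cases l <;> simp at h h0 <;> simp [h, h0] at hd
      simp [h, h0]
    · have : ∀ x : F, ((a:F)⁻¹ * u.1 0 l - x * u.1 1 l = 0) ↔ x = (a:F)⁻¹ * u.1 0 l / u.1 1 l := by
        intro x; rw [eq_div_iff h, sub_eq_zero, eq_comm]
      simp [this]
  simp only [key]
  by_cases h : u.1 1 l = 0 <;> simp [h, card_units_cast, ← hq]

lemma Y1_Ysame (q : K) (hq : q = Fintype.card F) (i j l : Fin 2) :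
    YY K F i j * YY K F j l = (q - 1) • (JJ K F - YY K F i l) := by
  have h1 : YY K F 1 j * YY K F j l = (q - 1) • (JJ K F - YY K F 1 l) := by
    fin_cases j
    · exact S_Y0 q hq l
    · have := mul_w (K := K) (F := F) 1 0
      simp only [zero_add] at this
      simp only [Fin.mk_one, Fin.isValue]
      rw [← this, mul_assoc, w_mul]
      exact S_Y0 q hq l
  fin_cases i
  · have := congrArg (fun z => MonoidAlgebra.single (wE F) (1 : K) * z) h1
    simp only [← mul_assoc, w_mul, mul_smul_comm, w_mul_sub, w_J] at this
    exact this
  · exact h1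

lemma Y1_Ydiff (q : K) (hq : q = Fintype.card F) (i j l : Fin 2) :
    YY K F i j * YY K F (j+1) l = (q * (q - 1)) • YY K F i l := by
  have h1 : YY K F 1 j * YY K F (j+1) l = (q * (q - 1)) • YY K F 1 l := by
    fin_cases j
    · exact S_Y1 q hq l
    · have := mul_w (K := K) (F := F) 1 0
      simp only [zero_add] at this
      simp only [Fin.mk_one, Fin.isValue]
      rw [← this, mul_assoc, w_mul]
      exact S_Y1 q hq l
  fin_cases i
  · have := congrArg (fun z => MonoidAlgebra.single (wE F) (1 : K) * z) h1
    simp only [← mul_assoc, w_mul, mul_smul_comm, w_mul_sub, w_J] at this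
    exact this
  · exact h1

lemma Y_J (q : K) (hq : q = Fintype.card F) (i j : Fin 2) :
    YY K F i j * JJ K F = (q * (q - 1)) • JJ K F := by
  have h1 : YY K F 1 j * JJ K F = (q * (q - 1)) • JJ K F := by
    fin_cases j
    · exact S_J q hq
    · have := mul_w (K := K) (F := F) 1 0
      simp only [zero_add] at this
      simp only [Fin.mk_one, Fin.isValue]
      rw [← this, mul_assoc, w_J]
      exact S_J q hq
  fin_cases i
  · have := congrArg (fun z => MonoidAlgebra.single (wE F) (1 : K) * z) h1
    simp only [← mul_assoc, w_mul, mul_smul_comm, w_mul_sub, w_J] at this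
    exact this
  · exact h1

lemma J_eq (q : K) (hq : q = Fintype.card F) (h1 : q - 1 ≠ 0) :
    JJ K F = (q - 1)⁻¹ • (YY K F 1 0 * YY K F 0 0) + YY K F 1 0 := by
  rw [S_Y0 q hq, smul_smul, inv_mul_cancel₀ h1]; simp

lemma J_Y (q : K) (hq : q = Fintype.card F) (h1 : q - 1 ≠ 0) (i j : Fin 2) :
    JJ K F * YY K F i j = (q * (q - 1)) • JJ K F := by
  rw [J_eq q hq h1, add_mul, smul_mul_assoc, mul_assoc]
  fin_cases i
  · have := Y1_Ysame q hq (0 : Fin 2) 0 j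
    simp only [Fin.zero_eta, Fin.isValue]
    rw [this, mul_smul_comm, mul_sub, Y_J q hq, smul_smul, inv_mul_cancel₀ h1, ← J_eq q hq h1]
    simp
  · have := Y1_Ydiff q hq (0 : Fin 2) 0 j
    simp only [zero_add] at this
    simp only [Fin.mk_one, Fin.isValue]
    rw [this, mul_smul_comm, S_Y0 q hq, S_Y1 q hq, ← J_eq q hq h1]
    match_scalars <;> field_simp
    ring

lemma J_J (q : K) (hq : q = Fintype.card F) (h1 : q - 1 ≠ 0) :
    JJ K F * JJ K F = (q * (q - 1) * (q + 1)) • JJ K F := by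
  conv_lhs => enter [1]; rw [J_eq q hq h1]
  rw [add_mul, smul_mul_assoc, mul_assoc, Y_J q hq, mul_smul_comm, Y_J q hq]
  match_scalars
  field_simp

lemma supp_ofFun (b₁₁ b₁₂ b₂₁ b₂₂ : Bool) : suppClass K F b₁₁ b₁₂ b₂₁ b₂₂ =
    ofFun K F (fun g => if ((b₁₁ = true ↔ g.1 0 0 ≠ 0) ∧ (b₁₂ = true ↔ g.1 0 1 ≠ 0) ∧
        (b₂₁ = true ↔ g.1 1 0 ≠ 0) ∧ (b₂₂ = true ↔ g.1 1 1 ≠ 0)) then 1 else 0) := by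
  unfold suppClass ofFun
  rw [Finset.sum_filter]
  refine Finset.sum_congr rfl fun g _ => ?_
  split_ifs with h
  · exact (congrArg (MonoidAlgebra.single g) (if_pos h)).symm
  · exact ((congrArg (MonoidAlgebra.single g) (if_neg h)).trans (MonoidAlgebra.single_zero g)).symm

lemma supp_simp (g : SLF F) : g.1 0 0 * g.1 1 1 - g.1 0 1 * g.1 1 0 = 1 := by
  rw [← Matrix.det_fin_two]; exact g.2

lemma e10 : YY K F 1 0 = elA K F + elDp K F := by
  simp only [elA, elDp, supp_ofFun, YY, ← ofFun_add]
  congr 1; ext g; have := supp_simp g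
  by_cases h1 : g.1 0 0 = 0 <;> by_cases h2 : g.1 0 1 = 0 <;> by_cases h3 : g.1 1 0 = 0 <;>
    by_cases h4 : g.1 1 1 = 0 <;> simp [h1, h2, h3, h4] at this ⊢

lemma e00 : YY K F 0 0 = elB K F + elEm K F := by
  simp only [elB, elEm, supp_ofFun, YY, ← ofFun_add]
  congr 1; ext g; have := supp_simp g
  by_cases h1 : g.1 0 0 = 0 <;> by_cases h2 : g.1 0 1 = 0 <;> by_cases h3 : g.1 1 0 = 0 <;>
    by_cases h4 : g.1 1 1 = 0 <;> simp [h1, h2, h3, h4] at this ⊢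

lemma e11 : YY K F 1 1 = elB K F + elEp K F := by
  simp only [elB, elEp, supp_ofFun, YY, ← ofFun_add]
  congr 1; ext g; have := supp_simp g
  by_cases h1 : g.1 0 0 = 0 <;> by_cases h2 : g.1 0 1 = 0 <;> by_cases h3 : g.1 1 0 = 0 <;>
    by_cases h4 : g.1 1 1 = 0 <;> simp [h1, h2, h3, h4] at this ⊢

lemma e01 : YY K F 0 1 = elA K F + elDm K F := by
  simp only [elA, elDm, supp_ofFun, YY, ← ofFun_add]
  congr 1; ext g; have := supp_simp g
  by_cases h1 : g.1 0 0 = 0 <;> by_cases h2 : g.1 0 1 = 0 <;> by_cases h3 : g.1 1 0 = 0 <;>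
    by_cases h4 : g.1 1 1 = 0 <;> simp [h1, h2, h3, h4] at this ⊢

lemma eJ : JJ K F = elA K F + elB K F + elC K F + elDp K F + elDm K F + elEp K F + elEm K F := by
  simp only [elA, elB, elC, elDp, elDm, elEp, elEm, supp_ofFun, JJ, ← ofFun_add]
  congr 1; ext g; have := supp_simp g
  by_cases h1 : g.1 0 0 = 0 <;> by_cases h2 : g.1 0 1 = 0 <;> by_cases h3 : g.1 1 0 = 0 <;>
    by_cases h4 : g.1 1 1 = 0 <;> simp [h1, h2, h3, h4] at this ⊢

end helpers

theorem exotic_embedding (F : Type*) [Field F] [Fintype F] [DecidableEq F]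
    (hq : 2 < Fintype.card F)
    (K : Type*) [Field K] (q : K) (hqc : q = Fintype.card F)
    (hchar : 2 * (q ^ 2 - 1) ≠ 0)
    (M₁₁ M₁₂ M₂₁ M₂₂ : MonoidAlgebra K (Matrix.SpecialLinearGroup (Fin 2) F))
    (hM₁₁ : M₁₁ = (q ^ 2 - 1)⁻¹ • (elA K F - elB K F) +
      (2 * (q ^ 2 - 1))⁻¹ • (elDp K F + elDm K F - elEp K F - elEm K F))
    (hM₁₂ : M₁₂ = (2 * (q - 1) ^ 2)⁻¹ • (elDp K F - elDm K F + elEp K F - elEm K F))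
    (hM₂₁ : M₂₁ = (2 * (q ^ 2 - 1))⁻¹ • (elDp K F - elDm K F - elEp K F + elEm K F))
    (hM₂₂ : M₂₂ = (q ^ 2 - 1)⁻¹ • (elA K F + elB K F) -
      (2 / ((q + 1) * (q - 1) ^ 2)) • elC K F +
      ((q - 3) / (2 * (q + 1) * (q - 1) ^ 2)) • (elDp K F + elDm K F + elEp K F + elEm K F))
    (φ : Matrix (Fin 2) (Fin 2) K → MonoidAlgebra K (Matrix.SpecialLinearGroup (Fin 2) F))
    (hφ : ∀ m : Matrix (Fin 2) (Fin 2) K,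
      φ m = m 0 0 • M₁₁ + m 0 1 • M₁₂ + m 1 0 • M₂₁ + m 1 1 • M₂₂) :
    Function.Injective φ ∧ ∀ x y : Matrix (Fin 2) (Fin 2) K, φ (x * y) = φ x * φ y := by
  have h2 : (2 : K) ≠ 0 := left_ne_zero_of_mul hchar
  have h3 : (q + 1) * (q - 1) ≠ 0 := by
    have := right_ne_zero_of_mul hchar
    intro h; apply this; linear_combination h
  have hp : q + 1 ≠ 0 := left_ne_zero_of_mul h3
  have hm : q - 1 ≠ 0 := right_ne_zero_of_mul h3
  have hf : q ^ 2 - 1 = (q + 1) * (q - 1) := by ring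
  rw [hf] at hM₁₁ hM₂₁ hM₂₂
  have N₁₁ : M₁₁ = (2 * ((q + 1) * (q - 1)))⁻¹ •
      (YY K F 1 0 + YY K F 0 1 - YY K F 1 1 - YY K F 0 0) := by
    rw [hM₁₁, e10, e01, e11, e00]; match_scalars <;> field_simp <;> ring
  have N₁₂ : M₁₂ = (2 * (q - 1) ^ 2)⁻¹ •
      (YY K F 1 0 - YY K F 0 1 + YY K F 1 1 - YY K F 0 0) := by
    rw [hM₁₂, e10, e01, e11, e00]; match_scalars <;> field_simp <;> ring
  have N₂₁ : M₂₁ = (2 * ((q + 1) * (q - 1)))⁻¹ •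
      (YY K F 1 0 - YY K F 0 1 - YY K F 1 1 + YY K F 0 0) := by
    rw [hM₂₁, e10, e01, e11, e00]; match_scalars <;> field_simp <;> ring
  have N₂₂ : M₂₂ = (2 * (q - 1) ^ 2)⁻¹ •
      (YY K F 1 0 + YY K F 0 1 + YY K F 1 1 + YY K F 0 0)
      - (2 / ((q + 1) * (q - 1) ^ 2)) • JJ K F := by
    rw [hM₂₂, e10, e01, e11, e00, eJ]; match_scalars <;> field_simp <;> ring
  have s := Y1_Ysame (K := K) (F := F) q hqc
  have d0 : ∀ i l : Fin 2, YY K F i 0 * YY K F 1 l = _ := fun i l => Y1_Ydiff q hqc i 0 l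
  have d1 : ∀ i l : Fin 2, YY K F i 1 * YY K F 0 l = _ := fun i l => Y1_Ydiff q hqc i 1 l
  have yj := Y_J (K := K) (F := F) q hqc
  have jy := J_Y (K := K) (F := F) q hqc hm
  have jj := J_J (K := K) (F := F) q hqc hm
  have hmul : ∀ x y : Matrix (Fin 2) (Fin 2) K, φ (x * y) = φ x * φ y := by
    intro x y
    simp only [hφ, N₁₁, N₁₂, N₂₁, N₂₂, Matrix.mul_apply, Fin.sum_univ_two]
    simp only [add_mul, sub_mul, mul_add, mul_sub, smul_mul_assoc, mul_smul_comm, s, d0, d1, yj,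
      jy, jj]
    match_scalars <;> field_simp <;> ring
  refine ⟨?_, hmul⟩
  have hne : M₁₁ ≠ 0 := by
    intro h
    have hz : (0 : MonoidAlgebra K (SLF F)) = ofFun K F 0 := by simp [ofFun]
    rw [N₁₁, hz] at h
    simp only [YY, ← ofFun_add, ← ofFun_sub, ← ofFun_smul] at h
    have := ofFun_inj h 1
    simp [h2, hp, hm] at this
    norm_num at this
    exact h2 this
  have hsub : ∀ x y, φ (x - y) = φ x - φ y := by
    intro x y; simp only [hφ, Matrix.sub_apply]; module
  intro x y hxy
  have h0 : φ (x - y) = 0 := by rw [hsub, hxy, sub_self]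
  rw [← sub_eq_zero]
  ext i j
  have e := hmul (Matrix.single 0 i 1 * (x - y)) (Matrix.single j 0 1)
  rw [hmul (Matrix.single 0 i 1) (x - y), h0, mul_zero, zero_mul, Matrix.single_mul_mul_single, hφ] at e
  simpa [Matrix.single, hne] using e
end
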